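/- Let (W,S) be an irreducible Coxeter system such that W is infinite and the canonical bilinear form is not positive semidefinite (i.e., W is non-spherical and non-affine). Then W is strongly indecomposable: every finite index subgroup G of W is indecomposable, i.e., if A and B are subgroups of G with G the internal direct product A × B, then A = {1} or B = {1}. -/

import Mathlib

/-!
Statement 13 (Theorem 4.1.2): Let (W,S) be an irreducible Coxeter system such that W is
infinite and the canonical bilinear form is not positive semidefinite (i.e., W is non-spherical
and non-affine). Then W is strongly indecomposable: every finite index subgroup G of W is
indecomposable.
-/

noncomputable section

namespace CoxeterPaper

variable {B : Type*} {W : Type*} [Group W]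

/-- The entry `⟨α_s, α_t⟩` of the canonical bilinear form: `-cos (π / m_{s,t})` if
`m_{s,t} < ∞`, and `-1` if `m_{s,t} = ∞` (encoded by `M s t = 0`). -/
noncomputable def formEntry (M : CoxeterMatrix B) (s t : B) : ℝ :=
  if M s t = 0 then -1 else -Real.cos (Real.pi / (M s t : ℝ))

/-- The canonical bilinear form on `V = ⊕_{s ∈ S} ℝ α_s`, identified with `B → ℝ` via the
basis of simple roots. -/
noncomputable def canonicalForm [Fintype B] (M : CoxeterMatrix B) (x y : B → ℝ) : ℝ :=
  ∑ s, ∑ t, x s * y t * formEntry M s t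

/-- The Coxeter graph of `M`: vertex set `B`, with `s, t` joined by an edge iff `m_{s,t} ≥ 3`
(where `m_{s,t} = ∞` is encoded by `M s t = 0`). -/
def coxeterGraph (M : CoxeterMatrix B) : SimpleGraph B :=
  SimpleGraph.fromRel (fun s t => M s t = 0 ∨ 3 ≤ M s t)

/-! ### The canonical form and the geometric representation -/

theorem formEntry_comm (M : CoxeterMatrix B) (s t : B) : formEntry M s t = formEntry M t s := by
  simp [formEntry, M.symmetric s t]

theorem formEntry_self (M : CoxeterMatrix B) (s : B) : formEntry M s s = 1 := by
  simp [formEntry]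

theorem neg_one_le_formEntry (M : CoxeterMatrix B) (s t : B) : -1 ≤ formEntry M s t := by
  unfold formEntry
  split_ifs
  · exact le_rfl
  · linarith [Real.cos_le_one (Real.pi / (M s t : ℝ))]

theorem two_le_of_ne (M : CoxeterMatrix B) {s t : B} (h : s ≠ t) (h0 : M s t ≠ 0) :
    2 ≤ M s t := by
  have := M.off_diagonal s t h
  omega

theorem formEntry_nonpos (M : CoxeterMatrix B) {s t : B} (h : s ≠ t) : formEntry M s t ≤ 0 := by
  unfold formEntry
  split_ifs with h0
  · norm_num
  · have h2 : (2 : ℝ) ≤ M s t := by exact_mod_cast two_le_of_ne M h h0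
    have : 0 ≤ Real.cos (Real.pi / (M s t : ℝ)) := by
      apply Real.cos_nonneg_of_mem_Icc
      constructor
      · have := Real.pi_pos
        have : 0 ≤ Real.pi / (M s t : ℝ) := by positivity
        linarith
      · exact div_le_div_of_nonneg_left Real.pi_pos.le (by norm_num) h2
    linarith

theorem formEntry_neg_of_adj (M : CoxeterMatrix B) {s t : B} (h : (coxeterGraph M).Adj s t) :
    formEntry M s t < 0 := by
  rw [coxeterGraph, SimpleGraph.fromRel_adj, M.symmetric t s, or_self] at h
  unfold formEntry
  split_ifs with h0
  · norm_num
  · have h3 : (3 : ℝ) ≤ M s t := by exact_mod_cast h.2.resolve_left h0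
    have : 0 < Real.cos (Real.pi / (M s t : ℝ)) := by
      apply Real.cos_pos_of_mem_Ioo
      constructor
      · have := Real.pi_pos
        have : 0 ≤ Real.pi / (M s t : ℝ) := by positivity
        linarith
      · exact div_lt_div_of_pos_left Real.pi_pos (by norm_num) (by linarith)
    linarith

open Classical in
/-- The simple root attached to `s`. -/
def simpleRoot (s : B) : B → ℝ := Pi.single s 1

@[simp] theorem simpleRoot_self (s : B) : simpleRoot s s = 1 := by simp [simpleRoot]

theorem simpleRoot_of_ne {s t : B} (h : t ≠ s) : simpleRoot s t = 0 := by simp [simpleRoot, h]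

theorem simpleRoot_nonneg (s : B) : 0 ≤ simpleRoot s := by
  intro t
  by_cases h : t = s
  · subst h; simp
  · simp [simpleRoot_of_ne h]

theorem simpleRoot_ne_zero (s : B) : simpleRoot s ≠ 0 := fun h => by
  simpa using congrFun h s

/-- The sequence `sin (k θ) / sin θ` where `c = cos θ`, defined by its recurrence. -/
def sinRatio (c : ℝ) : ℕ → ℝ
  | 0 => 0
  | 1 => 1
  | k + 2 => 2 * c * sinRatio c (k + 1) - sinRatio c k

theorem sinRatio_cos_mul_sin (θ : ℝ) (k : ℕ) :
    sinRatio (Real.cos θ) k * Real.sin θ = Real.sin (k * θ) ∧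
      sinRatio (Real.cos θ) (k + 1) * Real.sin θ = Real.sin ((k + 1 : ℕ) * θ) := by
  induction k with
  | zero => simp [sinRatio]
  | succ k ih =>
    refine ⟨ih.2, ?_⟩
    rw [sinRatio, sub_mul, mul_assoc, ih.1, ih.2]
    have h1 : ((k + 1 + 1 : ℕ) : ℝ) * θ = (k + 1 : ℕ) * θ + θ := by push_cast; ring
    have h2 : (k : ℝ) * θ = (k + 1 : ℕ) * θ - θ := by push_cast; ring
    rw [h1, h2, Real.sin_add, Real.sin_sub]
    ring

theorem sinRatio_one (k : ℕ) : sinRatio 1 k = k ∧ sinRatio 1 (k + 1) = k + 1 := by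
  induction k with
  | zero => simp [sinRatio]
  | succ k ih =>
    refine ⟨by rw [ih.2]; push_cast; ring, ?_⟩
    rw [sinRatio, ih.1, ih.2]
    push_cast
    ring

theorem sin_pi_div_pos {m : ℕ} (hm : 2 ≤ m) : 0 < Real.sin (Real.pi / (m : ℝ)) := by
  have h2 : (2 : ℝ) ≤ m := by exact_mod_cast hm
  apply Real.sin_pos_of_pos_of_lt_pi
  · have := Real.pi_pos; positivity
  · rw [div_lt_iff₀ (by linarith)]
    nlinarith [Real.pi_pos]

theorem sinRatio_nonneg (M : CoxeterMatrix B) {s t : B} (hst : s ≠ t) {k : ℕ}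
    (hk : M s t = 0 ∨ k ≤ M s t) : 0 ≤ sinRatio (-formEntry M s t) k := by
  by_cases h0 : M s t = 0
  · have : -formEntry M s t = 1 := by simp [formEntry, h0]
    rw [this, (sinRatio_one k).1]
    positivity
  · have hc : -formEntry M s t = Real.cos (Real.pi / (M s t : ℝ)) := by simp [formEntry, h0]
    have hs := sin_pi_div_pos (two_le_of_ne M hst h0)
    have hm : (0 : ℝ) < M s t := by exact_mod_cast Nat.pos_of_ne_zero h0
    rw [hc]
    have h := (sinRatio_cos_mul_sin (Real.pi / (M s t : ℝ)) k).1
    have hk' : (k : ℝ) ≤ M s t := by exact_mod_cast hk.resolve_left h0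
    have hnn : 0 ≤ Real.sin (k * (Real.pi / (M s t : ℝ))) := by
      apply Real.sin_nonneg_of_nonneg_of_le_pi
      · have := Real.pi_pos; positivity
      · rw [← mul_div_assoc, div_le_iff₀ hm]
        nlinarith [Real.pi_pos]
    rw [← h] at hnn
    exact nonneg_of_mul_nonneg_left hnn hs

theorem exists_alternatingWord_mul_simple {M : CoxeterMatrix B} (cs : CoxeterSystem M W)
    (s t : B) (h0 : M s t ≠ 0) (j : ℕ) :
    ∃ ω : List B, ω.length + 1 = M s t + j ∧
      cs.wordProd (CoxeterSystem.alternatingWord s t (M s t + j)) * cs.simple s =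
        cs.wordProd ω := by
  induction j with
  | zero =>
    obtain ⟨m, hm⟩ := Nat.exists_eq_succ_of_ne_zero h0
    refine ⟨CoxeterSystem.alternatingWord s t m, by simp [hm], ?_⟩
    have h := cs.wordProd_braidWord_eq s t
    unfold CoxeterSystem.braidWord at h
    rw [add_zero, h, M.symmetric t s, hm, CoxeterSystem.alternatingWord_succ,
      cs.wordProd_concat, mul_assoc, cs.simple_mul_simple_self, mul_one]
  | succ j ih =>
    obtain ⟨ω, hω, h⟩ := ih
    refine ⟨(if Even (M s t + j) then t else s) :: ω, by simp; omega, ?_⟩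
    rw [← add_assoc, CoxeterSystem.alternatingWord_succ', cs.wordProd_cons, mul_assoc, h,
      cs.wordProd_cons]

section Representation

variable [Fintype B]

/-- The canonical form as a bilinear map. -/
def bil (M : CoxeterMatrix B) : (B → ℝ) →ₗ[ℝ] (B → ℝ) →ₗ[ℝ] ℝ :=
  LinearMap.mk₂ ℝ (canonicalForm M)
    (fun x y z => by
      simp only [canonicalForm, Pi.add_apply, add_mul, Finset.sum_add_distrib])
    (fun c x y => by
      simp only [canonicalForm, Pi.smul_apply, smul_eq_mul, Finset.mul_sum, mul_assoc])
    (fun x y z => by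
      simp only [canonicalForm, Pi.add_apply, mul_add, add_mul, Finset.sum_add_distrib])
    (fun c x y => by
      simp only [canonicalForm, Pi.smul_apply, smul_eq_mul, Finset.mul_sum]
      refine Finset.sum_congr rfl fun s _ => Finset.sum_congr rfl fun t _ => ?_
      ring)

theorem bil_apply (M : CoxeterMatrix B) (x y : B → ℝ) :
    bil M x y = ∑ s, ∑ t, x s * y t * formEntry M s t := rfl

theorem bil_comm (M : CoxeterMatrix B) (x y : B → ℝ) : bil M x y = bil M y x := by
  rw [bil_apply, bil_apply, Finset.sum_comm]
  refine Finset.sum_congr rfl fun s _ => Finset.sum_congr rfl fun t _ => ?_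
  rw [formEntry_comm]
  ring

theorem eq_sum_simpleRoot (x : B → ℝ) : x = ∑ s, x s • simpleRoot s := by
  classical
  ext t
  rw [Finset.sum_apply, Finset.sum_eq_single t]
  · simp
  · intro s _ h; simp [simpleRoot_of_ne (Ne.symm h)]
  · simp

theorem bil_simpleRoot_right (M : CoxeterMatrix B) (x : B → ℝ) (t : B) :
    bil M x (simpleRoot t) = ∑ s, x s * formEntry M s t := by
  classical
  rw [bil_apply]
  refine Finset.sum_congr rfl fun s _ => ?_
  rw [Finset.sum_eq_single t]
  · simp
  · intro u _ h; simp [simpleRoot_of_ne h]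
  · simp

theorem bil_simpleRoot (M : CoxeterMatrix B) (s t : B) :
    bil M (simpleRoot s) (simpleRoot t) = formEntry M s t := by
  classical
  rw [bil_simpleRoot_right, Finset.sum_eq_single s]
  · simp
  · intro u _ h; simp [simpleRoot_of_ne h]
  · simp

/-- The map `x ↦ x - 2 ⟨p, x⟩ p`. -/
def reflMap (M : CoxeterMatrix B) (p : B → ℝ) : Module.End ℝ (B → ℝ) :=
  LinearMap.id - (2 : ℝ) • (bil M p).smulRight p

theorem reflMap_apply (M : CoxeterMatrix B) (p x : B → ℝ) :
    reflMap M p x = x - (2 * bil M p x) • p := by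
  simp [reflMap, smul_smul]

theorem reflMap_simpleRoot_self (M : CoxeterMatrix B) (s : B) :
    reflMap M (simpleRoot s) (simpleRoot s) = -simpleRoot s := by
  rw [reflMap_apply, bil_simpleRoot, formEntry_self]
  module

theorem reflMap_simpleRoot (M : CoxeterMatrix B) (s t : B) :
    reflMap M (simpleRoot s) (simpleRoot t) =
      simpleRoot t + (2 * -formEntry M s t) • simpleRoot s := by
  rw [reflMap_apply, bil_simpleRoot]
  module

theorem reflMap_mul_self (M : CoxeterMatrix B) (s : B) :
    reflMap M (simpleRoot s) * reflMap M (simpleRoot s) = 1 := by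
  ext1 x
  simp only [Module.End.mul_apply, Module.End.one_apply, reflMap_apply, map_sub, map_smul,
    bil_simpleRoot, formEntry_self]
  module

theorem reflMap_mul_pow_simpleRoot (M : CoxeterMatrix B) (s t : B) (n : ℕ) :
    ((reflMap M (simpleRoot s) * reflMap M (simpleRoot t)) ^ n) (simpleRoot s) =
      sinRatio (-formEntry M s t) (2 * n + 1) • simpleRoot s +
        sinRatio (-formEntry M s t) (2 * n) • simpleRoot t := by
  induction n with
  | zero => simp [sinRatio]
  | succ n ih =>
    rw [pow_succ', Module.End.mul_apply, ih, Module.End.mul_apply]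
    have e1 : sinRatio (-formEntry M s t) (2 * (n + 1)) =
        2 * -formEntry M s t * sinRatio (-formEntry M s t) (2 * n + 1) -
          sinRatio (-formEntry M s t) (2 * n) := rfl
    have e2 : sinRatio (-formEntry M s t) (2 * (n + 1) + 1) =
        2 * -formEntry M s t * sinRatio (-formEntry M s t) (2 * (n + 1)) -
          sinRatio (-formEntry M s t) (2 * n + 1) := rfl
    simp only [map_add, map_smul, reflMap_simpleRoot_self, reflMap_simpleRoot, map_neg]
    rw [e2, e1, formEntry_comm M t s]
    module

theorem reflMap_mul_pow_simpleRoot_left (M : CoxeterMatrix B) {s t : B} (hst : s ≠ t)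
    (h0 : M s t ≠ 0) :
    ((reflMap M (simpleRoot s) * reflMap M (simpleRoot t)) ^ M s t) (simpleRoot s) =
      simpleRoot s := by
  have hc : -formEntry M s t = Real.cos (Real.pi / (M s t : ℝ)) := by simp [formEntry, h0]
  have hs := (sin_pi_div_pos (two_le_of_ne M hst h0)).ne'
  have hm : (M s t : ℝ) ≠ 0 := by exact_mod_cast h0
  rw [reflMap_mul_pow_simpleRoot, hc]
  obtain ⟨h1, h2⟩ := sinRatio_cos_mul_sin (Real.pi / (M s t : ℝ)) (2 * M s t)
  have a1 : ((2 * M s t : ℕ) : ℝ) * (Real.pi / (M s t : ℝ)) = 2 * Real.pi := by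
    push_cast; field_simp
  have a2 : ((2 * M s t + 1 : ℕ) : ℝ) * (Real.pi / (M s t : ℝ)) =
      Real.pi / (M s t : ℝ) + 2 * Real.pi := by
    push_cast; field_simp; ring
  rw [a1, Real.sin_two_pi] at h1
  rw [a2, Real.sin_add_two_pi] at h2
  rw [(mul_eq_zero.mp h1).resolve_right hs, mul_right_cancel₀ hs (h2.trans (one_mul _).symm)]
  simp

theorem reflMap_mul_pow (M : CoxeterMatrix B) (s t : B) :
    (reflMap M (simpleRoot s) * reflMap M (simpleRoot t)) ^ M s t = 1 := by
  by_cases hst : s = t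
  · subst hst
    rw [M.diagonal, pow_one, reflMap_mul_self]
  by_cases h0 : M s t = 0
  · rw [h0, pow_zero]
  set a := reflMap M (simpleRoot s)
  set b := reflMap M (simpleRoot t)
  have hα : ((a * b) ^ M s t) (simpleRoot s) = simpleRoot s :=
    reflMap_mul_pow_simpleRoot_left M hst h0
  have hβ' : ((b * a) ^ M s t) (simpleRoot t) = simpleRoot t := by
    rw [M.symmetric s t]
    exact reflMap_mul_pow_simpleRoot_left M (Ne.symm hst) (by rwa [M.symmetric t s])
  have hinv : ∀ n : ℕ, (a * b) ^ n * (b * a) ^ n = 1 := by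
    intro n
    induction n with
    | zero => simp
    | succ n ih =>
      calc (a * b) ^ (n + 1) * (b * a) ^ (n + 1)
          = (a * b) ^ n * (a * (b * b) * a) * (b * a) ^ n := by
            rw [pow_succ, pow_succ']; simp only [mul_assoc]
        _ = 1 := by rw [reflMap_mul_self, mul_one, reflMap_mul_self, mul_one, ih]
  have hβ : ((a * b) ^ M s t) (simpleRoot t) = simpleRoot t := by
    conv_lhs => rw [← hβ']
    rw [← Module.End.mul_apply, hinv, Module.End.one_apply]
  set e := formEntry M s t with he
  have hc : e = -Real.cos (Real.pi / (M s t : ℝ)) := by simp [he, formEntry, h0]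
  have hne : 1 - e ^ 2 ≠ 0 := by
    have hs := sin_pi_div_pos (two_le_of_ne M hst h0)
    rw [hc]
    nlinarith [Real.sin_sq_add_cos_sq (Real.pi / (M s t : ℝ))]
  have hfix : ∀ z, bil M (simpleRoot s) z = 0 → bil M (simpleRoot t) z = 0 → ∀ n : ℕ,
      ((a * b) ^ n) z = z := by
    intro z h1 h2 n
    induction n with
    | zero => simp
    | succ n ih =>
      rw [pow_succ, Module.End.mul_apply, Module.End.mul_apply]
      have hb : b z = z := by simp [b, reflMap_apply, h2]
      have ha : a z = z := by simp [a, reflMap_apply, h1]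
      rw [hb, ha, ih]
  ext1 x
  set u := bil M (simpleRoot s) x with hu
  set v := bil M (simpleRoot t) x with hv
  have hst' : bil M (simpleRoot s) (simpleRoot t) = e := bil_simpleRoot M s t
  have hts' : bil M (simpleRoot t) (simpleRoot s) = e := by rw [bil_comm, hst']
  have hss : bil M (simpleRoot s) (simpleRoot s) = 1 := by rw [bil_simpleRoot, formEntry_self]
  have htt : bil M (simpleRoot t) (simpleRoot t) = 1 := by rw [bil_simpleRoot, formEntry_self]
  set y := ((u - e * v) / (1 - e ^ 2)) • simpleRoot s + ((v - e * u) / (1 - e ^ 2)) • simpleRoot t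
    with hy
  have hz := hfix (x - y)
    (by
      simp only [hy, map_sub, map_add, map_smul, hst', hss, smul_eq_mul, ← hu]
      field_simp
      ring)
    (by
      simp only [hy, map_sub, map_add, map_smul, hts', htt, smul_eq_mul, ← hv]
      field_simp
      ring) (M s t)
  have hyf : ((a * b) ^ M s t) y = y := by
    simp only [hy, map_add, map_smul, hα, hβ]
  rw [map_sub, hyf] at hz
  simpa using hz

variable {M : CoxeterMatrix B} (cs : CoxeterSystem M W)

/-- The geometric representation of a Coxeter group. -/
def rep : W →* Module.End ℝ (B → ℝ) :=
  cs.lift ⟨fun s => reflMap M (simpleRoot s), fun s t => reflMap_mul_pow M s t⟩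

theorem rep_simple (s : B) : rep cs (cs.simple s) = reflMap M (simpleRoot s) :=
  cs.lift_apply_simple _ s

theorem rep_mul_apply (v w : W) (x : B → ℝ) : rep cs (v * w) x = rep cs v (rep cs w x) := by
  rw [map_mul, Module.End.mul_apply]

theorem rep_one_apply (x : B → ℝ) : rep cs 1 x = x := by
  rw [map_one, Module.End.one_apply]

theorem rep_inv_apply_self (w : W) (x : B → ℝ) : rep cs w⁻¹ (rep cs w x) = x := by
  rw [← rep_mul_apply, inv_mul_cancel, rep_one_apply]

theorem rep_apply_inv_self (w : W) (x : B → ℝ) : rep cs w (rep cs w⁻¹ x) = x := by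
  rw [← rep_mul_apply, mul_inv_cancel, rep_one_apply]

theorem rep_injective (w : W) : Function.Injective (rep cs w) :=
  Function.LeftInverse.injective (rep_inv_apply_self cs w)

theorem rep_simple_apply (s : B) (x : B → ℝ) :
    rep cs (cs.simple s) x = x - (2 * bil M (simpleRoot s) x) • simpleRoot s := by
  rw [rep_simple, reflMap_apply]

theorem bil_rep (w : W) (x y : B → ℝ) : bil M (rep cs w x) (rep cs w y) = bil M x y := by
  induction w using cs.simple_induction_left with
  | one => simp
  | mul_simple_left w s ih =>
    rw [rep_mul_apply, rep_mul_apply, rep_simple_apply, rep_simple_apply]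
    simp only [map_sub, map_smul, LinearMap.sub_apply, LinearMap.smul_apply, smul_eq_mul,
      bil_simpleRoot, formEntry_self, bil_comm M _ (simpleRoot s), ih]
    ring

/-! ### Positivity of roots -/

theorem rep_alternatingWord (s t : B) (k : ℕ) :
    rep cs (cs.wordProd (CoxeterSystem.alternatingWord s t k)) (simpleRoot s) =
      sinRatio (-formEntry M s t) (k + 1) • simpleRoot (if Even (k + 1) then t else s) +
        sinRatio (-formEntry M s t) k • simpleRoot (if Even k then t else s) := by
  induction k with
  | zero => simp [CoxeterSystem.alternatingWord, sinRatio]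
  | succ k ih =>
    rw [CoxeterSystem.alternatingWord_succ', cs.wordProd_cons, rep_mul_apply, ih, rep_simple,
      map_add, map_smul, map_smul, reflMap_simpleRoot_self, reflMap_simpleRoot]
    have e : sinRatio (-formEntry M s t) (k + 1 + 1) =
        2 * -formEntry M s t * sinRatio (-formEntry M s t) (k + 1) -
          sinRatio (-formEntry M s t) k := rfl
    rw [e]
    by_cases hk : Even k
    · have h1 : ¬ Even (k + 1) := by simp [hk, parity_simps]
      have h2 : Even (k + 1 + 1) := by simp [hk, parity_simps]
      simp only [hk, h1, h2, if_true, if_false, formEntry_comm M t s]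
      module
    · have h1 : Even (k + 1) := by simp [hk, parity_simps]
      have h2 : ¬ Even (k + 1 + 1) := by simp [hk, parity_simps]
      simp only [hk, h1, h2, if_true, if_false]
      module

theorem rep_simpleRoot_nonneg (w : W) (s : B) (h : ¬ cs.IsRightDescent w s) :
    0 ≤ rep cs w (simpleRoot s) := by
  classical
  induction hn : cs.length w using Nat.strong_induction_on generalizing w s with
  | _ n ih =>
  subst hn
  by_cases hw : w = 1
  · subst hw; simpa using simpleRoot_nonneg s
  obtain ⟨t, ht⟩ := cs.exists_rightDescent_of_ne_one hw
  have hst : s ≠ t := by rintro rfl; exact h ht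
  set P : ℕ → Prop := fun k => ∃ v, w = v * cs.wordProd (CoxeterSystem.alternatingWord s t k) ∧
    cs.length w = cs.length v + k with hP
  have hP1 : P 1 := by
    refine ⟨w * cs.simple t, ?_, ?_⟩
    · simp [CoxeterSystem.alternatingWord]
    · exact (cs.isRightDescent_iff.mp ht).symm
  set k := Nat.findGreatest P (cs.length w) with hk
  have hlen1 : 1 ≤ cs.length w := by obtain ⟨v, -, hv⟩ := hP1; omega
  have hk1 : 1 ≤ k := Nat.le_findGreatest hlen1 hP1
  have hPk : P k := Nat.findGreatest_spec hlen1 hP1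
  have hmax : ¬ P (k + 1) := by
    intro hc
    have hle : k + 1 ≤ cs.length w := by obtain ⟨v, -, hv⟩ := hc; omega
    exact absurd (Nat.le_findGreatest hle hc) (by omega)
  obtain ⟨v, hwv, hlv⟩ := hPk
  have hx : ¬ cs.IsRightDescent v (if Even k then t else s) := by
    intro hd
    apply hmax
    refine ⟨v * cs.simple (if Even k then t else s), ?_, ?_⟩
    · rw [CoxeterSystem.alternatingWord_succ', cs.wordProd_cons, mul_assoc,
        cs.simple_mul_simple_cancel_left, hwv]
    · have := cs.isRightDescent_iff.mp hd
      omega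
  have hy : ¬ cs.IsRightDescent v (if Even (k + 1) then t else s) := by
    intro hd
    obtain ⟨j, hj⟩ := Nat.exists_eq_succ_of_ne_zero (show k ≠ 0 by omega)
    have hpar : (if Even (k + 1) then t else s) = (if Even j then t else s) := by
      have : Even (k + 1) ↔ Even j := by rw [hj]; simp [parity_simps]
      simp only [this]
    rw [hpar] at hd
    rw [hj, CoxeterSystem.alternatingWord_succ', cs.wordProd_cons, ← mul_assoc] at hwv
    have h1 := cs.length_mul_le (v * cs.simple (if Even j then t else s))
      (cs.wordProd (CoxeterSystem.alternatingWord s t j))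
    have h2 := cs.length_wordProd_le (CoxeterSystem.alternatingWord s t j)
    rw [CoxeterSystem.length_alternatingWord] at h2
    rw [← hwv] at h1
    have := cs.isRightDescent_iff.mp hd
    omega
  have hkm : M s t = 0 ∨ k + 1 ≤ M s t := by
    by_contra hc
    push Not at hc
    obtain ⟨h0, hlt⟩ := hc
    obtain ⟨j, hj⟩ := Nat.exists_eq_add_of_le (show M s t ≤ k by omega)
    obtain ⟨ω, hω, hω'⟩ := exists_alternatingWord_mul_simple cs s t h0 j
    rw [← hj] at hω hω'
    apply h
    have h1 := cs.length_mul_le v (cs.wordProd ω)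
    have h2 := cs.length_wordProd_le ω
    rw [← hω', ← mul_assoc, ← hwv] at h1
    unfold CoxeterSystem.IsRightDescent
    rw [hω'] at h1
    omega
  rw [hwv, rep_mul_apply, rep_alternatingWord, map_add, map_smul, map_smul]
  have hlt : cs.length v < cs.length w := by omega
  exact add_nonneg
    (smul_nonneg (sinRatio_nonneg M hst hkm) (ih _ hlt v _ hy rfl))
    (smul_nonneg (sinRatio_nonneg M hst (hkm.imp id (by omega))) (ih _ hlt v _ hx rfl))

theorem rep_simpleRoot_nonpos (w : W) (s : B) (h : cs.IsRightDescent w s) :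
    rep cs w (simpleRoot s) ≤ 0 := by
  have h1 := rep_simpleRoot_nonneg cs (w * cs.simple s) s
    (cs.isRightDescent_iff_not_isRightDescent_mul.mp h)
  rw [rep_mul_apply, rep_simple, reflMap_simpleRoot_self, map_neg] at h1
  exact neg_nonneg.mp h1

theorem rep_faithful : Function.Injective (rep cs) := by
  rw [injective_iff_map_eq_one]
  intro w hw
  by_contra hne
  obtain ⟨s, hs⟩ := cs.exists_rightDescent_of_ne_one hne
  have := rep_simpleRoot_nonpos cs w s hs
  rw [hw, Module.End.one_apply] at this
  exact simpleRoot_ne_zero s (le_antisymm this (simpleRoot_nonneg s))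

end Representation

theorem connected_induction {M : CoxeterMatrix B} (hirr : (coxeterGraph M).Connected)
    {P : B → Prop} {s : B} (hs : P s)
    (hstep : ∀ s t, (coxeterGraph M).Adj s t → P s → P t) (t : B) : P t := by
  obtain ⟨w⟩ := hirr.preconnected s t
  induction w with
  | nil => exact hs
  | cons h _ ih => exact ih (hstep _ _ h hs)

section Roots

variable [Fintype B] {M : CoxeterMatrix B} (cs : CoxeterSystem M W)

/-- The roots are the translates of the simple roots. -/
def IsRoot (p : B → ℝ) : Prop := ∃ w s, p = rep cs w (simpleRoot s)

theorem isRoot_simpleRoot (s : B) : IsRoot cs (simpleRoot s) := ⟨1, s, by simp⟩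

variable {cs}

theorem IsRoot.rep {p : B → ℝ} (hp : IsRoot cs p) (w : W) : IsRoot cs (rep cs w p) := by
  obtain ⟨v, s, rfl⟩ := hp
  exact ⟨w * v, s, (rep_mul_apply cs w v _).symm⟩

theorem IsRoot.bil_self {p : B → ℝ} (hp : IsRoot cs p) : bil M p p = 1 := by
  obtain ⟨v, s, rfl⟩ := hp
  rw [bil_rep, bil_simpleRoot, formEntry_self]

theorem IsRoot.neg {p : B → ℝ} (hp : IsRoot cs p) : IsRoot cs (-p) := by
  obtain ⟨v, s, rfl⟩ := hp
  refine ⟨v * cs.simple s, s, ?_⟩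
  rw [rep_mul_apply, rep_simple, reflMap_simpleRoot_self, map_neg]

theorem IsRoot.ne_zero {p : B → ℝ} (hp : IsRoot cs p) : p ≠ 0 := by
  rintro rfl
  simpa using hp.bil_self

theorem IsRoot.nonneg_or_nonpos {p : B → ℝ} (hp : IsRoot cs p) : 0 ≤ p ∨ p ≤ 0 := by
  obtain ⟨v, s, rfl⟩ := hp
  by_cases h : cs.IsRightDescent v s
  · exact Or.inr (rep_simpleRoot_nonpos cs v s h)
  · exact Or.inl (rep_simpleRoot_nonneg cs v s h)

theorem IsRoot.eq_or_eq_neg_of_smul {p q : B → ℝ} (hp : IsRoot cs p) (hq : IsRoot cs q) {c : ℝ}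
    (h : q = c • p) : q = p ∨ q = -p := by
  have h1 := hq.bil_self
  rw [h] at h1
  simp only [map_smul, LinearMap.smul_apply, smul_eq_mul, hp.bil_self, mul_one] at h1
  rcases mul_self_eq_one_iff.mp h1 with rfl | rfl
  · left; simpa using h
  · right; simpa using h

theorem IsRoot.eq_simpleRoot {q : B → ℝ} (hq : IsRoot cs q) (h0 : 0 ≤ q) {s : B}
    (h : CoxeterPaper.rep cs (cs.simple s) q ≤ 0) : q = simpleRoot s := by
  have hqs : q = q s • simpleRoot s := by
    ext t
    by_cases hts : t = s
    · subst hts; simp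
    · have h1 := h t
      rw [rep_simple_apply] at h1
      simp only [Pi.sub_apply, Pi.smul_apply, simpleRoot_of_ne hts, smul_zero, sub_zero,
        Pi.zero_apply] at h1
      simp only [Pi.smul_apply, simpleRoot_of_ne hts, smul_zero]
      exact le_antisymm h1 (h0 t)
  rcases (isRoot_simpleRoot cs s).eq_or_eq_neg_of_smul hq hqs with h1 | h1
  · exact h1
  · have := h0 s
    rw [h1] at this
    simp at this
    norm_num at this

variable (cs)

theorem finite_inversions (w : W) :
    {p : B → ℝ | IsRoot cs p ∧ 0 ≤ p ∧ rep cs w p ≤ 0}.Finite := by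
  induction w using cs.simple_induction_left with
  | one =>
    refine (Set.finite_singleton 0).subset ?_
    rintro p ⟨-, h1, h2⟩
    rw [rep_one_apply] at h2
    exact le_antisymm h2 h1
  | mul_simple_left w s ih =>
    refine (ih.union (Set.finite_singleton (rep cs w⁻¹ (simpleRoot s)))).subset ?_
    rintro p ⟨hp, h1, h2⟩
    rcases (hp.rep w).nonneg_or_nonpos with h | h
    · right
      rw [rep_mul_apply] at h2
      rw [Set.mem_singleton_iff, ← (hp.rep w).eq_simpleRoot h h2, rep_inv_apply_self]
    · exact Or.inl ⟨hp, h1, h⟩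

/-- `r` acts as the orthogonal reflection in `p`. -/
def Reflects (r : W) (p : B → ℝ) : Prop := ∀ x, rep cs r x = x - (2 * bil M p x) • p

variable {cs}

theorem Reflects.conj {r : W} {p : B → ℝ} (h : Reflects cs r p) (w : W) :
    Reflects cs (w * r * w⁻¹) (rep cs w p) := by
  intro x
  rw [rep_mul_apply, rep_mul_apply, h, map_sub, map_smul, rep_apply_inv_self]
  congr 3
  rw [← bil_rep cs w, rep_apply_inv_self]

theorem reflects_simple (s : B) : Reflects cs (cs.simple s) (simpleRoot s) :=
  rep_simple_apply cs s

theorem IsRoot.exists_reflects {p : B → ℝ} (hp : IsRoot cs p) : ∃ r, Reflects cs r p := by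
  obtain ⟨w, s, rfl⟩ := hp
  exact ⟨_, (reflects_simple s).conj w⟩

theorem Reflects.mul_self {r : W} {p : B → ℝ} (h : Reflects cs r p) (hp : bil M p p = 1) :
    r * r = 1 := by
  apply rep_faithful cs
  ext1 x
  rw [rep_mul_apply, rep_one_apply, h, h]
  simp only [map_sub, map_smul, hp, smul_eq_mul]
  module

theorem eq_zero_of_nonneg_of_forall_bil_eq_zero (hirr : (coxeterGraph M).Connected)
    (hform : ¬ ∀ x : B → ℝ, 0 ≤ canonicalForm M x x) {r : B → ℝ} (h0 : 0 ≤ r)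
    (hr : ∀ x, bil M r x = 0) : r = 0 := by
  by_contra hne
  obtain ⟨s, hs⟩ := Function.ne_iff.mp hne
  have hpos : ∀ t, 0 < r t := by
    refine connected_induction hirr (lt_of_le_of_ne (h0 s) (Ne.symm hs)) ?_
    intro s t hst hs
    by_contra ht
    have ht0 : r t = 0 := le_antisymm (not_lt.mp ht) (h0 t)
    have h1 := hr (simpleRoot t)
    rw [bil_simpleRoot_right] at h1
    refine absurd h1 (ne_of_lt ?_)
    refine Finset.sum_neg' (fun u _ => ?_) ⟨s, Finset.mem_univ s, ?_⟩
    · by_cases hut : u = t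
      · rw [hut, ht0, zero_mul]
      · exact mul_nonpos_of_nonneg_of_nonpos (h0 u) (formEntry_nonpos M hut)
    · exact mul_neg_of_pos_of_neg hs (formEntry_neg_of_adj M hst)
  refine hform fun x => ?_
  have hrs : ∀ t, ∑ s, r s * formEntry M s t = 0 := fun t => by
    rw [← bil_simpleRoot_right, hr]
  set y : B → ℝ := fun s => x s / r s with hy
  have hx : ∀ s, x s = r s * y s := fun s => by
    have := (hpos s).ne'
    simp only [hy]
    field_simp
  have e1 : ∑ s, ∑ t, r s * r t * formEntry M s t * y t ^ 2 = 0 := by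
    rw [Finset.sum_comm]
    refine Finset.sum_eq_zero fun t _ => ?_
    rw [← mul_zero (r t * y t ^ 2), ← hrs t, Finset.mul_sum]
    exact Finset.sum_congr rfl fun s _ => by ring
  have e2 : ∑ s, ∑ t, r s * r t * formEntry M s t * y s ^ 2 = 0 := by
    refine Finset.sum_eq_zero fun s _ => ?_
    rw [← mul_zero (r s * y s ^ 2), ← hrs s, Finset.mul_sum]
    exact Finset.sum_congr rfl fun t _ => by rw [formEntry_comm M s t]; ring
  have e3 : canonicalForm M x x =
      (∑ s, ∑ t, r s * r t * formEntry M s t * y t ^ 2) / 2 +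
        (∑ s, ∑ t, r s * r t * formEntry M s t * y s ^ 2) / 2 +
          ∑ s, ∑ t, r s * r t * -formEntry M s t * (y s - y t) ^ 2 / 2 := by
    simp only [canonicalForm, Finset.sum_div, ← Finset.sum_add_distrib]
    refine Finset.sum_congr rfl fun s _ => Finset.sum_congr rfl fun t _ => ?_
    rw [hx s, hx t]
    ring
  rw [e3, e1, e2, zero_div, zero_add, zero_add]
  refine Finset.sum_nonneg fun s _ => Finset.sum_nonneg fun t _ => ?_
  by_cases hst : s = t
  · simp [hst]
  · have := formEntry_nonpos M hst
    have := mul_pos (hpos s) (hpos t)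
    have : 0 ≤ r s * r t * -formEntry M s t := mul_nonneg this.le (by linarith)
    positivity

theorem IsRoot.eq_of_forall_bil_sub_eq_zero (hirr : (coxeterGraph M).Connected)
    (hform : ¬ ∀ x : B → ℝ, 0 ≤ canonicalForm M x x) {p q : B → ℝ} (hp : IsRoot cs p)
    (hq : IsRoot cs q) (h : ∀ x, bil M (q - p) x = 0) : q = p := by
  by_contra hne
  set r := q - p with hr
  have hr0 : r ≠ 0 := sub_ne_zero.mpr hne
  obtain ⟨a, ha⟩ : ∃ a, 0 < r a := by
    by_contra hc
    push Not at hc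
    apply hr0
    rw [← neg_eq_zero]
    refine eq_zero_of_nonneg_of_forall_bil_eq_zero hirr hform (fun i => ?_) fun x => ?_
    · simpa using hc i
    · rw [map_neg, LinearMap.neg_apply, h, neg_zero]
  obtain ⟨b, hb⟩ : ∃ b, r b < 0 := by
    by_contra hc
    push Not at hc
    exact hr0 (eq_zero_of_nonneg_of_forall_bil_eq_zero hirr hform hc h)
  obtain ⟨u, hu⟩ := hp.exists_reflects
  obtain ⟨v, hv⟩ := hq.exists_reflects
  have hq' : q = p + r := by simp [hr]
  have hrx : ∀ x, bil M x r = 0 := fun x => by rw [bil_comm, h]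
  have hroot : ∀ n : ℕ, IsRoot cs (p + (2 * n : ℝ) • r) := by
    intro n
    induction n with
    | zero => simpa using hp
    | succ n ih =>
      convert (ih.rep u).rep v using 1
      rw [hv, hu, hq']
      simp only [map_add, map_sub, map_smul, LinearMap.add_apply, h, hrx, hp.bil_self,
        smul_eq_mul]
      push_cast
      module
  obtain ⟨n, hn⟩ := exists_nat_gt (max (-p a / (2 * r a)) (p b / (2 * -r b)))
  have h1 := (le_max_left _ _).trans_lt hn
  have h2 := (le_max_right _ _).trans_lt hn
  rw [div_lt_iff₀ (by linarith)] at h1 h2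
  rcases (hroot n).nonneg_or_nonpos with h3 | h3
  · have := h3 b
    simp only [Pi.zero_apply, Pi.add_apply, Pi.smul_apply, smul_eq_mul] at this
    linarith
  · have := h3 a
    simp only [Pi.zero_apply, Pi.add_apply, Pi.smul_apply, smul_eq_mul] at this
    linarith

theorem eq_top_of_invariant (hirr : (coxeterGraph M).Connected) {U : Submodule ℝ (B → ℝ)}
    (hU : ∀ s, ∀ x ∈ U, rep cs (cs.simple s) x ∈ U) {p : B → ℝ} (hp : IsRoot cs p) (hpU : p ∈ U) :
    U = ⊤ := by
  have hW : ∀ w : W, ∀ x ∈ U, rep cs w x ∈ U := by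
    intro w
    induction w using cs.simple_induction_left with
    | one => simp
    | mul_simple_left w s ih =>
      intro x hx
      rw [rep_mul_apply]
      exact hU s _ (ih x hx)
  obtain ⟨w, s, rfl⟩ := hp
  have hs : simpleRoot s ∈ U := by simpa [rep_inv_apply_self] using hW w⁻¹ _ hpU
  have hall : ∀ t, simpleRoot t ∈ U := by
    refine connected_induction hirr hs fun s t hst hs => ?_
    have h1 := U.sub_mem hs (hU t _ hs)
    rw [rep_simple_apply, sub_sub_cancel, bil_simpleRoot] at h1
    refine (U.smul_mem_iff (mul_ne_zero two_ne_zero ?_)).mp h1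
    exact (formEntry_neg_of_adj M hst.symm).ne
  rw [eq_top_iff]
  intro x _
  rw [eq_sum_simpleRoot x]
  exact U.sum_mem fun t _ => U.smul_mem _ (hall t)

variable (cs)

/-- The vectors with finite orbit under a normal subgroup. -/
def finiteOrbit (N : Subgroup W) : Submodule ℝ (B → ℝ) where
  carrier := {x | ((fun n => rep cs n x) '' (N : Set W)).Finite}
  add_mem' {x y} hx hy := by
    refine (hx.add hy).subset ?_
    rintro _ ⟨n, hn, rfl⟩
    exact ⟨_, ⟨n, hn, rfl⟩, _, ⟨n, hn, rfl⟩, (map_add _ _ _).symm⟩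
  zero_mem' := by
    refine (Set.finite_singleton 0).subset ?_
    rintro _ ⟨n, hn, rfl⟩
    simp
  smul_mem' c x hx := by
    refine (hx.image (c • ·)).subset ?_
    rintro _ ⟨n, hn, rfl⟩
    exact ⟨_, ⟨n, hn, rfl⟩, (map_smul _ _ _).symm⟩

variable {cs}

theorem IsRoot.infinite_orbit (hirr : (coxeterGraph M).Connected) (hinf : Infinite W)
    (N : Subgroup W) [N.Normal] [N.FiniteIndex] {p : B → ℝ} (hp : IsRoot cs p) :
    ((fun n => CoxeterPaper.rep cs n p) '' (N : Set W)).Infinite := by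
  intro hfin
  have htop : finiteOrbit cs N = ⊤ := by
    refine eq_top_of_invariant hirr (fun s x hx => ?_) hp hfin
    refine (Set.Finite.image (CoxeterPaper.rep cs (cs.simple s)) hx).subset ?_
    rintro _ ⟨n, hn, rfl⟩
    refine ⟨_, ⟨cs.simple s * n * (cs.simple s)⁻¹, Subgroup.Normal.conj_mem ‹_› n hn _, rfl⟩, ?_⟩
    simp only [← rep_mul_apply]
    congr 2
    simp [mul_assoc]
  have hfs : ∀ s : B, ((fun n => CoxeterPaper.rep cs n (simpleRoot s)) '' (N : Set W)).Finite := by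
    intro s
    have : simpleRoot s ∈ finiteOrbit cs N := htop ▸ Submodule.mem_top
    exact this
  have hN : (N : Set W).Finite := by
    refine Set.Finite.of_injOn (f := fun n s => CoxeterPaper.rep cs n (simpleRoot s))
      (t := Set.univ.pi fun s => (fun n => CoxeterPaper.rep cs n (simpleRoot s)) '' (N : Set W))
      ?_ ?_ (Set.Finite.pi' hfs |>.subset ?_)
    · intro n hn s _
      exact ⟨n, hn, rfl⟩
    · intro n _ m _ hnm
      apply rep_faithful cs
      ext1 x
      rw [eq_sum_simpleRoot x, map_sum, map_sum]
      refine Finset.sum_congr rfl fun s _ => ?_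
      rw [map_smul, map_smul]
      exact congrArg _ (congrFun hnm s)
    · intro f hf s
      exact hf s (Set.mem_univ s)
  have : Finite N := hN
  have : Finite W := (Subgroup.finite_iff_finite_and_finiteIndex N).mpr ⟨this, inferInstance⟩
  exact not_finite W

theorem IsRoot.exists_rep_ne (hirr : (coxeterGraph M).Connected) (hinf : Infinite W)
    (N : Subgroup W) [N.Normal] [N.FiniteIndex] {p : B → ℝ} (hp : IsRoot cs p) :
    ∃ n ∈ N, CoxeterPaper.rep cs n p ≠ p ∧ CoxeterPaper.rep cs n p ≠ -p := by
  by_contra hc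
  push Not at hc
  refine hp.infinite_orbit hirr hinf N ((Set.toFinite {p, -p}).subset ?_)
  rintro _ ⟨n, hn, rfl⟩
  by_cases h : CoxeterPaper.rep cs n p = p
  · exact Or.inl h
  · exact Or.inr (hc n hn h)

theorem IsRoot.exists_orthogonal (hirr : (coxeterGraph M).Connected)
    (hform : ¬ ∀ x : B → ℝ, 0 ≤ canonicalForm M x x) {p q : B → ℝ} (hp : IsRoot cs p)
    (hq : IsRoot cs q) (h1 : q ≠ p) (h2 : q ≠ -p) : ∃ x, bil M q x = 0 ∧ bil M p x ≠ 0 := by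
  by_contra hc
  push Not at hc
  have key : ∀ z, bil M p z = bil M q z * bil M p q := by
    intro z
    have := hc (z - bil M q z • q) (by simp [hq.bil_self])
    simpa [sub_eq_zero] using this
  have he : bil M p q * bil M p q = 1 := by
    rw [← hp.bil_self, key p, bil_comm M q p]
  rcases mul_self_eq_one_iff.mp he with h | h
  · refine h1 (hp.eq_of_forall_bil_sub_eq_zero hirr hform hq fun x => ?_)
    rw [map_sub, LinearMap.sub_apply, key, h, mul_one, sub_self]
  · refine h2 (hp.neg.eq_of_forall_bil_sub_eq_zero hirr hform hq fun x => ?_)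
    rw [sub_neg_eq_add, map_add, LinearMap.add_apply, key, h]
    ring

theorem rep_mem_span_pair_of_commute (hirr : (coxeterGraph M).Connected)
    (hform : ¬ ∀ x : B → ℝ, 0 ≤ canonicalForm M x x) {p q : B → ℝ} (hp : IsRoot cs p)
    (hq : IsRoot cs q) (h1 : q ≠ p) (h2 : q ≠ -p) {u v w : W} (hu : Reflects cs u p)
    (hv : Reflects cs v q) (hw : Commute w (u * v)) :
    rep cs w p ∈ Submodule.span ℝ {p, q} := by
  obtain ⟨x, hx, hx'⟩ := hp.exists_orthogonal hirr hform hq h1 h2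
  have hb : rep cs (u * v) x = x - (2 * bil M p x) • p := by
    rw [rep_mul_apply, hv, hx, mul_zero, zero_smul, sub_zero, hu]
  have e1 : (2 * bil M p x) • rep cs w p = rep cs w x - rep cs (u * v) (rep cs w x) := by
    rw [← rep_mul_apply, ← hw.eq, rep_mul_apply, hb, map_sub, map_smul]
    module
  rw [← Submodule.smul_mem_iff _ (mul_ne_zero two_ne_zero hx'), e1, rep_mul_apply, hu, hv]
  have hpm : p ∈ Submodule.span ℝ {p, q} := Submodule.subset_span (by simp)
  have hqm : q ∈ Submodule.span ℝ {p, q} := Submodule.subset_span (by simp)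
  rw [← sub_add, sub_sub_cancel]
  exact Submodule.add_mem _ (Submodule.smul_mem _ _ hqm) (Submodule.smul_mem _ _ hpm)

end Roots

section Flat

variable [Fintype B] {M : CoxeterMatrix B} {cs : CoxeterSystem M W}

theorem canonicalForm_nonneg_of_card_le_two (h : Fintype.card B ≤ 2) (x : B → ℝ) :
    0 ≤ canonicalForm M x x := by
  classical
  by_cases hB : ∃ s t : B, s ≠ t
  · obtain ⟨s, t, hst⟩ := hB
    have hu : (Finset.univ : Finset B) = {s, t} :=
      (Finset.eq_of_subset_of_card_le (Finset.subset_univ _)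
        (by rw [Finset.card_pair hst]; exact h)).symm
    unfold canonicalForm
    rw [hu, Finset.sum_pair hst, Finset.sum_pair hst, Finset.sum_pair hst, formEntry_self,
      formEntry_self, formEntry_comm M t s]
    have h1 := neg_one_le_formEntry M s t
    have h2 := formEntry_nonpos M hst
    nlinarith [mul_nonneg (by linarith : 0 ≤ 1 + formEntry M s t)
      (add_nonneg (sq_nonneg (x s)) (sq_nonneg (x t))),
      mul_nonneg (by linarith : 0 ≤ -formEntry M s t) (sq_nonneg (x s - x t))]
  · push Not at hB
    refine Finset.sum_nonneg fun s _ => Finset.sum_nonneg fun t _ => ?_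
    rw [hB t s, formEntry_self, mul_one]
    exact mul_self_nonneg _

theorem not_span_pair_eq_top (hform : ¬ ∀ x : B → ℝ, 0 ≤ canonicalForm M x x) (p q : B → ℝ) :
    Submodule.span ℝ {p, q} ≠ ⊤ := by
  classical
  intro h
  refine hform (canonicalForm_nonneg_of_card_le_two ?_)
  have h1 := finrank_span_finset_le_card (R := ℝ) ({p, q} : Finset (B → ℝ))
  rw [Set.finrank, Finset.coe_pair, h, finrank_top, Module.finrank_fintype_fun_eq_card] at h1
  exact h1.trans Finset.card_le_two

/-- A pair of independent roots spanning a plane preserved by a normal subgroup of `W`. -/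
structure IsFlat (cs : CoxeterSystem M W) (N : Subgroup W) (p q : B → ℝ) : Prop where
  isRoot : IsRoot cs p
  exists_rep : ∃ h ∈ N, q = rep cs h p
  ne : q ≠ p
  ne_neg : q ≠ -p
  mem : ∀ n ∈ N, rep cs n p ∈ Submodule.span ℝ {p, q}

namespace IsFlat

variable {N : Subgroup W} {p q : B → ℝ}

theorem isRoot_right (h : IsFlat cs N p q) : IsRoot cs q := by
  obtain ⟨n, -, rfl⟩ := h.exists_rep
  exact h.isRoot.rep n

theorem rep_mem (h : IsFlat cs N p q) {n : W} (hn : n ∈ N) {x : B → ℝ}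
    (hx : x ∈ Submodule.span ℝ {p, q}) : rep cs n x ∈ Submodule.span ℝ {p, q} := by
  obtain ⟨a, b, rfl⟩ := Submodule.mem_span_pair.mp hx
  obtain ⟨m, hm, hq⟩ := h.exists_rep
  rw [map_add, map_smul, map_smul]
  refine Submodule.add_mem _ (Submodule.smul_mem _ _ (h.mem n hn)) (Submodule.smul_mem _ _ ?_)
  have := h.mem _ (N.mul_mem hn hm)
  rwa [rep_mul_apply, ← hq] at this

end IsFlat

theorem IsRoot.eq_zero_of_smul_add_smul {p q : B → ℝ} (hp : IsRoot cs p) (hq : IsRoot cs q)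
    (h1 : q ≠ p) (h2 : q ≠ -p) {a b : ℝ} (h : a • p + b • q = 0) : a = 0 ∧ b = 0 := by
  have hb : b = 0 := by
    by_contra hb
    have : q = (-a / b) • p := by
      have h3 : b • q = (-a) • p := by
        rw [neg_smul]; exact eq_neg_of_add_eq_zero_right h
      rw [div_eq_inv_mul, mul_smul, ← h3, smul_smul, inv_mul_cancel₀ hb, one_smul]
    exact (hp.eq_or_eq_neg_of_smul hq this).elim h1 h2
  subst hb
  rw [zero_smul, add_zero] at h
  exact ⟨(smul_eq_zero.mp h).resolve_right hp.ne_zero, rfl⟩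

/-- The key dichotomy excluded below: a simple reflection `t` moving a flat plane can only do so
if the form is degenerate on the plane, with radical orthogonal to the simple root of `t`. -/
theorem IsFlat.degenerate (hirr : (coxeterGraph M).Connected) (hinf : Infinite W)
    {N : Subgroup W} [N.Normal] [N.FiniteIndex] {p q : B → ℝ} (h : IsFlat cs N p q) {t : B}
    (ht : ¬ ∀ x ∈ Submodule.span ℝ {p, q}, rep cs (cs.simple t) x ∈ Submodule.span ℝ {p, q}) :
    bil M q (q - bil M p q • p) = 0 ∧ bil M (simpleRoot t) (q - bil M p q • p) = 0 := by
  set P := Submodule.span ℝ {p, q} with hP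
  set α : B → ℝ := simpleRoot t with hα
  set τ := cs.simple t with hτ
  have hpP : p ∈ P := Submodule.subset_span (by simp)
  have hqP : q ∈ P := Submodule.subset_span (by simp)
  have hτα : ∀ x, rep cs τ x = x - (2 * bil M α x) • α := rep_simple_apply cs t
  have hττ : ∀ x, rep cs τ (rep cs τ x) = x := fun x => by
    rw [← rep_mul_apply, hτ, cs.simple_mul_simple_self, rep_one_apply]
  have hαP : α ∉ P := fun hc => ht fun x hx => by
    rw [hτα]
    exact P.sub_mem hx (P.smul_mem _ hc)
  have horth : ∀ y ∈ P, rep cs τ y ∈ P → bil M α y = 0 := by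
    intro y hy hty
    by_contra hc
    rw [hτα, P.sub_mem_iff_right hy, P.smul_mem_iff (mul_ne_zero two_ne_zero hc)] at hty
    exact hαP hty
  set a := bil M α p with ha
  set b := bil M α q with hb
  have hab : ¬ (a = 0 ∧ b = 0) := by
    rintro ⟨h1, h2⟩
    refine ht fun x hx => ?_
    obtain ⟨c, d, rfl⟩ := Submodule.mem_span_pair.mp hx
    rw [hτα, map_add, map_smul, map_smul, ← ha, ← hb, h1, h2]
    simpa using hx
  set v := b • p - a • q with hv
  have hvP : v ∈ P := P.sub_mem (P.smul_mem _ hpP) (P.smul_mem _ hqP)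
  have hαv : bil M α v = 0 := by
    rw [hv, map_sub, map_smul, map_smul, ← ha, ← hb, smul_eq_mul, smul_eq_mul]
    ring
  have hτv : rep cs τ v = v := by rw [hτα, hαv]; simp
  have hv0 : v ≠ 0 := fun hc => by
    obtain ⟨h1, h2⟩ := h.isRoot.eq_zero_of_smul_add_smul h.isRoot_right h.ne h.ne_neg
      (a := b) (b := -a) (by rw [← hc, hv]; module)
    exact hab ⟨neg_eq_zero.mp h2, h1⟩
  have hline : ∀ y ∈ P, rep cs τ y ∈ P → ∃ c : ℝ, y = c • v := by
    intro y hy hty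
    have h1 := horth y hy hty
    obtain ⟨c, d, rfl⟩ := Submodule.mem_span_pair.mp hy
    rw [map_add, map_smul, map_smul, ← ha, ← hb, smul_eq_mul, smul_eq_mul] at h1
    by_cases hb0 : b = 0
    · have ha0 : a ≠ 0 := fun hc => hab ⟨hc, hb0⟩
      have hc0 : c = 0 := by simpa [hb0, ha0] using h1
      refine ⟨-d / a, ?_⟩
      have hd : d = (-d / a) * -a := by field_simp
      rw [hv, hb0, hc0]
      conv_lhs => rw [hd]
      module
    · refine ⟨c / b, ?_⟩
      have hd : d = -(c * a) / b := by field_simp; linarith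
      rw [hv, smul_sub, smul_smul, smul_smul, div_mul_cancel₀ _ hb0, hd, sub_eq_add_neg,
        ← neg_smul]
      congr 2
      ring
  have hconj : ∀ n ∈ N, τ * n * τ ∈ N := fun n hn => by
    have := Subgroup.Normal.conj_mem ‹N.Normal› n hn τ
    rwa [hτ, cs.inv_simple] at this
  have hrepconj : ∀ n x, rep cs τ (rep cs n x) = rep cs (τ * n * τ) (rep cs τ x) := by
    intro n x
    rw [rep_mul_apply, rep_mul_apply, hττ]
  have hNv : ∀ n ∈ N, ∃ c : ℝ, rep cs n v = c • v := by
    intro n hn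
    refine hline _ (h.rep_mem hn hvP) ?_
    rw [hrepconj, hτv]
    exact h.rep_mem (hconj n hn) hvP
  obtain ⟨r, hr⟩ := h.isRoot.exists_reflects
  have hb_mem : ∀ g ∈ N, r * (g * r * g⁻¹) ∈ N := by
    intro g hg
    have h1 : r⁻¹ = r := inv_eq_of_mul_eq_one_left (hr.mul_self h.isRoot.bil_self)
    have h2 := N.mul_mem (Subgroup.Normal.conj_mem ‹N.Normal› g hg r) (N.inv_mem hg)
    rw [h1] at h2
    simpa only [mul_assoc] using h2
  have hb_apply : ∀ g x, rep cs (r * (g * r * g⁻¹)) x = x - (2 * bil M (rep cs g p) x) • rep cs g p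
      - (2 * bil M p x - 4 * bil M (rep cs g p) x * bil M p (rep cs g p)) • p := by
    intro g x
    rw [rep_mul_apply, hr.conj g, hr, map_sub, map_smul, smul_eq_mul]
    module
  have hfix : ∀ g ∈ N, rep cs g p ≠ p → rep cs g p ≠ -p →
      rep cs (r * (g * r * g⁻¹)) v = v → bil M p v = 0 ∧ bil M (rep cs g p) v = 0 := by
    intro g hg h1 h2 h3
    rw [hb_apply] at h3
    obtain ⟨h4, h5⟩ := h.isRoot.eq_zero_of_smul_add_smul (h.isRoot.rep g) h1 h2
      (a := 2 * bil M p v - 4 * bil M (rep cs g p) v * bil M p (rep cs g p))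
      (b := 2 * bil M (rep cs g p) v) (by
        rw [sub_sub, sub_eq_self] at h3
        rw [add_comm]
        exact h3)
    have h6 : bil M (rep cs g p) v = 0 := by linarith
    rw [h6] at h4
    exact ⟨by linarith, h6⟩
  have hpp := h.isRoot.bil_self
  have hqq := h.isRoot_right.bil_self
  obtain ⟨g, hg, hgq⟩ := h.exists_rep
  by_cases hvv : bil M v v = 0
  · by_cases hvP' : bil M p v = 0 ∧ bil M q v = 0
    · set e := bil M p q with he
      have h1 := hvP'.1
      have h2 := hvP'.2
      simp only [hv, map_sub, map_smul, hpp, hqq, bil_comm M q p, ← he, smul_eq_mul] at h1 h2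
      have ha0 : a ≠ 0 := by
        intro hc
        rw [hc] at h1
        exact hab ⟨hc, by linarith⟩
      constructor
      · rw [map_sub, map_smul, hqq, bil_comm M q p, ← he, smul_eq_mul]
        have : a * (1 - e * e) = 0 := by
          have : b = a * e := by linarith
          rw [this] at h2
          linarith
        exact (mul_eq_zero.mp this).resolve_left ha0
      · rw [map_sub, map_smul, ← ha, ← hb, smul_eq_mul]
        linarith
    · exfalso
      obtain ⟨y, hyP, hyv⟩ : ∃ y ∈ P, bil M y v ≠ 0 := by
        by_contra hc
        push Not at hc
        exact hvP' ⟨hc p hpP, hc q hqP⟩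
      set β := r * (g * r * g⁻¹) with hβ
      have hβN := hb_mem g hg
      obtain ⟨μ, hμ⟩ := hNv β hβN
      have hβP : ∀ x, rep cs β x - x ∈ P := by
        intro x
        rw [hβ, hb_apply, ← hgq, sub_sub x, sub_sub_cancel_left]
        exact P.neg_mem (P.add_mem (P.smul_mem _ hqP) (P.smul_mem _ hpP))
      obtain ⟨c, hc⟩ := hline (rep cs β (rep cs τ y) - rep cs τ y) (hβP _) (by
        rw [map_sub, hrepconj, hττ]
        exact P.sub_mem (h.rep_mem (hconj _ hβN) hyP) hyP)
      have hτyv : bil M (rep cs τ y) v = bil M y v := by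
        conv_lhs => rw [← hτv]
        rw [bil_rep]
      have h1 := bil_rep cs β (rep cs τ y) v
      rw [sub_eq_iff_eq_add.mp hc, hμ, map_add, LinearMap.add_apply, map_smul, map_smul, map_smul,
        LinearMap.smul_apply, hvv, hτyv, smul_eq_mul, smul_eq_mul, mul_zero, mul_zero, zero_add,
        smul_eq_mul, mul_left_eq_self₀] at h1
      rw [h1.resolve_right hyv, one_smul] at hμ
      refine hvP' ?_
      have := hfix g hg (hgq ▸ h.ne) (hgq ▸ h.ne_neg) hμ
      rwa [← hgq] at this
  · exfalso
    have horthp : ∀ n ∈ N, rep cs n p ≠ p → rep cs n p ≠ -p → bil M p (rep cs n p) = 0 := by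
      intro n hn h1 h2
      obtain ⟨μ, hμ⟩ := hNv _ (hb_mem n hn)
      have h3 := bil_rep cs (r * (n * r * n⁻¹)) v v
      rw [hμ, map_smul, map_smul, LinearMap.smul_apply, smul_eq_mul, smul_eq_mul, ← mul_assoc,
        mul_left_eq_self₀] at h3
      have hvspan : v ∈ Submodule.span ℝ {p, rep cs n p} := by
        obtain ⟨c, d, hcd⟩ := Submodule.mem_span_pair.mp (h.mem n hn)
        have hd : d ≠ 0 := by
          rintro rfl
          rw [zero_smul, add_zero] at hcd
          exact (h.isRoot.eq_or_eq_neg_of_smul (h.isRoot.rep n) hcd.symm).elim h1 h2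
        have hpm : p ∈ Submodule.span ℝ {p, rep cs n p} := Submodule.subset_span (by simp)
        have hnm : rep cs n p ∈ Submodule.span ℝ {p, rep cs n p} := Submodule.subset_span (by simp)
        have hqm : q ∈ Submodule.span ℝ {p, rep cs n p} := by
          rw [← Submodule.smul_mem_iff _ hd, eq_sub_of_add_eq' hcd]
          exact Submodule.sub_mem _ hnm (Submodule.smul_mem _ _ hpm)
        exact Submodule.sub_mem _ (Submodule.smul_mem _ _ hpm) (Submodule.smul_mem _ _ hqm)
      obtain ⟨x, y, hxy⟩ := Submodule.mem_span_pair.mp hvspan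
      rcases mul_self_eq_one_iff.mp (h3.resolve_right hvv) with h4 | h4
      · exfalso
        rw [h4, one_smul] at hμ
        obtain ⟨h5, h6⟩ := hfix n hn h1 h2 hμ
        apply hvv
        have h7 : bil M (x • p + y • rep cs n p) v = 0 := by simp [h5, h6]
        rwa [hxy] at h7
      · rw [h4, hb_apply] at hμ
        have hnn := (h.isRoot.rep n).bil_self
        set e := bil M p (rep cs n p) with he
        have hpv : bil M p v = x + y * e := by
          rw [← hxy]; simp [hpp, ← he]
        have hnv : bil M (rep cs n p) v = x * e + y := by
          rw [← hxy]; simp [hnn, bil_comm M _ p, ← he]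
        rw [hpv, hnv, ← hxy] at hμ
        obtain ⟨h5, h6⟩ := h.isRoot.eq_zero_of_smul_add_smul (h.isRoot.rep n) h1 h2
          (a := 2 * x - (2 * (x + y * e) - 4 * (x * e + y) * e))
          (b := 2 * y - 2 * (x * e + y)) (by
            rw [← sub_eq_zero] at hμ
            rw [← hμ]
            module)
        have h7 : x * e = 0 := by linarith
        rw [h7] at h5
        have h8 : y * e = 0 := by linarith
        by_contra he0
        apply hv0
        rw [← hxy, (mul_eq_zero.mp h7).resolve_right he0, (mul_eq_zero.mp h8).resolve_right he0]
        simp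
    have hpq : bil M p q = 0 := by
      rw [hgq]
      exact horthp g hg (hgq ▸ h.ne) (hgq ▸ h.ne_neg)
    refine h.isRoot.infinite_orbit hirr hinf N ((Set.toFinite {p, -p, q, -q}).subset ?_)
    rintro _ ⟨n, hn, rfl⟩
    by_cases h1 : rep cs n p = p
    · simp [h1]
    by_cases h2 : rep cs n p = -p
    · simp [h2]
    have h3 := horthp n hn h1 h2
    obtain ⟨c, d, hcd⟩ := Submodule.mem_span_pair.mp (h.mem n hn)
    rw [← hcd, map_add, map_smul, map_smul, hpp, hpq, smul_zero, add_zero, smul_eq_mul,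
      mul_one] at h3
    rw [h3, zero_smul, zero_add] at hcd
    rcases h.isRoot_right.eq_or_eq_neg_of_smul (h.isRoot.rep n) hcd.symm with h4 | h4
    · simp [h4]
    · simp [h4]

theorem not_isFlat (hirr : (coxeterGraph M).Connected) (hinf : Infinite W)
    (hform : ¬ ∀ x : B → ℝ, 0 ≤ canonicalForm M x x)
    {N : Subgroup W} [N.Normal] [N.FiniteIndex] {p q : B → ℝ} : ¬ IsFlat cs N p q := by
  intro h
  have hpP : p ∈ Submodule.span ℝ {p, q} := Submodule.subset_span (by simp)
  have hqP : q ∈ Submodule.span ℝ {p, q} := Submodule.subset_span (by simp)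
  have hpp := h.isRoot.bil_self
  by_cases hall : ∀ t, ∀ x ∈ Submodule.span ℝ {p, q},
      rep cs (cs.simple t) x ∈ Submodule.span ℝ {p, q}
  · exact not_span_pair_eq_top hform p q (eq_top_of_invariant hirr hall h.isRoot hpP)
  · obtain ⟨t₀, ht₀⟩ := not_forall.mp hall
    obtain ⟨hq, -⟩ := h.degenerate hirr hinf ht₀
    set u := q - bil M p q • p with hu
    have hp : bil M p u = 0 := by simp [hu, hpp]
    have hrad : ∀ t, bil M (simpleRoot t) u = 0 := by
      intro t
      by_cases ht : ∀ x ∈ Submodule.span ℝ {p, q},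
          rep cs (cs.simple t) x ∈ Submodule.span ℝ {p, q}
      · by_contra hc
        have huP : u ∈ Submodule.span ℝ {p, q} :=
          Submodule.sub_mem _ hqP (Submodule.smul_mem _ _ hpP)
        have h1 := ht u huP
        rw [rep_simple_apply, Submodule.sub_mem_iff_right _ huP,
          Submodule.smul_mem_iff _ (mul_ne_zero two_ne_zero hc)] at h1
        obtain ⟨c, d, hcd⟩ := Submodule.mem_span_pair.mp h1
        apply hc
        rw [← hcd]
        simp [hp, hq]
      · exact (h.degenerate hirr hinf ht).2
    have hrad' : ∀ x, bil M u x = 0 := by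
      intro x
      rw [bil_comm, eq_sum_simpleRoot x]
      simp [hrad]
    have he : bil M p q * bil M p q = 1 := by
      have := hq
      rw [hu, map_sub, map_smul, h.isRoot_right.bil_self, bil_comm M q p, smul_eq_mul] at this
      linarith
    rcases mul_self_eq_one_iff.mp he with h1 | h1
    · refine h.ne (h.isRoot.eq_of_forall_bil_sub_eq_zero hirr hform h.isRoot_right ?_)
      simpa [hu, h1] using hrad'
    · refine h.ne_neg (h.isRoot.neg.eq_of_forall_bil_sub_eq_zero hirr hform h.isRoot_right ?_)
      simpa [hu, h1] using hrad'

theorem IsRoot.exists_rep_notMem (hirr : (coxeterGraph M).Connected) (hinf : Infinite W)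
    (hform : ¬ ∀ x : B → ℝ, 0 ≤ canonicalForm M x x)
    (N : Subgroup W) [N.Normal] [N.FiniteIndex] {p : B → ℝ} (hp : IsRoot cs p) {h : W}
    (hh : h ∈ N) (h1 : CoxeterPaper.rep cs h p ≠ p) (h2 : CoxeterPaper.rep cs h p ≠ -p) :
    ∃ n ∈ N, CoxeterPaper.rep cs n p ∉ Submodule.span ℝ {p, CoxeterPaper.rep cs h p} := by
  by_contra hc
  push Not at hc
  exact not_isFlat hirr hinf hform ⟨hp, ⟨h, hh, rfl⟩, h1, h2, hc⟩

/-- An element whose centralizer has finite index is trivial. -/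
theorem eq_one_of_finiteIndex_le_centralizer (hirr : (coxeterGraph M).Connected)
    (hinf : Infinite W) (hform : ¬ ∀ x : B → ℝ, 0 ≤ canonicalForm M x x)
    (cs : CoxeterSystem M W) (H : Subgroup W) [H.FiniteIndex] {w : W}
    (hw : ∀ g ∈ H, Commute w g) : w = 1 := by
  set N := H.normalCore with hN
  have hNw : ∀ g ∈ N, Commute w g := fun g hg => hw g (H.normalCore_le hg)
  have hpm : ∀ p, IsRoot cs p → rep cs w p = p ∨ rep cs w p = -p := by
    intro p hp
    obtain ⟨h, hh, h1, h2⟩ := hp.exists_rep_ne hirr hinf N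
    obtain ⟨h', hh', h3⟩ := hp.exists_rep_notMem hirr hinf hform N hh h1 h2
    obtain ⟨r, hr⟩ := hp.exists_reflects
    have hmem : ∀ g ∈ N, r * (g * r * g⁻¹) ∈ N := by
      intro g hg
      have h1 : r⁻¹ = r := inv_eq_of_mul_eq_one_left (hr.mul_self hp.bil_self)
      have h2 := N.mul_mem (Subgroup.Normal.conj_mem inferInstance g hg r) (N.inv_mem hg)
      rw [h1] at h2
      simpa only [mul_assoc] using h2
    have hpP : p ∈ Submodule.span ℝ {p, rep cs h p} := Submodule.subset_span (by simp)
    have h1' : rep cs h' p ≠ p := fun hc => h3 (by rw [hc]; exact hpP)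
    have h2' : rep cs h' p ≠ -p := fun hc =>
      h3 (by rw [hc]; exact Submodule.neg_mem _ hpP)
    have m1 := rep_mem_span_pair_of_commute hirr hform hp (hp.rep h) h1 h2 hr (hr.conj h)
      (hNw _ (hmem h hh))
    have m2 := rep_mem_span_pair_of_commute hirr hform hp (hp.rep h') h1' h2' hr (hr.conj h')
      (hNw _ (hmem h' hh'))
    obtain ⟨c, d, hcd⟩ := Submodule.mem_span_pair.mp m2
    have hd : d = 0 := by
      by_contra hd
      apply h3
      rw [← Submodule.smul_mem_iff _ hd, eq_sub_of_add_eq' hcd]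
      exact Submodule.sub_mem _ m1 (Submodule.smul_mem _ _ hpP)
    rw [hd, zero_smul, add_zero] at hcd
    exact hp.eq_or_eq_neg_of_smul (hp.rep w) hcd.symm
  have hext : ∀ ε : ℝ, (∀ s : B, rep cs w (simpleRoot s) = ε • simpleRoot s) →
      ∀ x, rep cs w x = ε • x := by
    intro ε hs x
    conv_lhs => rw [eq_sum_simpleRoot x]
    conv_rhs => rw [eq_sum_simpleRoot x]
    rw [map_sum, Finset.smul_sum]
    refine Finset.sum_congr rfl fun s _ => ?_
    rw [map_smul, hs, smul_comm]
  obtain ⟨s₀⟩ := hirr.nonempty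
  have hsign : ∀ ε : ℝ, rep cs w (simpleRoot s₀) = ε • simpleRoot s₀ → (ε = 1 ∨ ε = -1) →
      ∀ s : B, rep cs w (simpleRoot s) = ε • simpleRoot s := by
    intro ε h0 hε
    refine connected_induction hirr h0 fun s t hst hs => ?_
    have h1 := bil_rep cs w (simpleRoot s) (simpleRoot t)
    have h2 := (formEntry_neg_of_adj M hst).ne
    rw [← bil_simpleRoot] at h2
    rcases hpm _ (isRoot_simpleRoot cs t) with h3 | h3 <;> rcases hε with rfl | rfl
    · simpa using h3
    · exfalso
      rw [hs, h3] at h1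
      simp at h1
      exact h2 (by linarith)
    · exfalso
      rw [hs, h3] at h1
      simp at h1
      exact h2 (by linarith)
    · simpa using h3
  rcases hpm _ (isRoot_simpleRoot cs s₀) with h0 | h0
  · apply rep_faithful cs
    ext1 x
    rw [hext 1 (hsign 1 (by simpa using h0) (Or.inl rfl)) x, rep_one_apply, one_smul]
  · exfalso
    have hneg := hext (-1) (hsign (-1) (by simpa using h0) (Or.inr rfl))
    refine (isRoot_simpleRoot cs s₀).infinite_orbit hirr hinf ⊤
      (((finite_inversions cs w).union (finite_inversions cs w).neg).subset ?_)
    rintro _ ⟨n, -, rfl⟩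
    have hn := (isRoot_simpleRoot cs s₀).rep n
    rcases hn.nonneg_or_nonpos with h1 | h1
    · refine Or.inl ⟨hn, h1, ?_⟩
      rw [hneg]
      simpa using h1
    · refine Or.inr ⟨hn.neg, by simpa using h1, ?_⟩
      rw [hneg]
      simpa using h1

end Flat

section Decomposition

theorem finiteIndex_of_cover (C : Subgroup W) {F : Set W} (hF : F.Finite)
    (h : ∀ w, ∃ f ∈ F, f⁻¹ * w ∈ C) : C.FiniteIndex := by
  have hfin : (Set.univ : Set (W ⧸ C)).Finite := by
    refine (hF.image (QuotientGroup.mk : W → W ⧸ C)).subset fun x _ => ?_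
    obtain ⟨w, rfl⟩ := QuotientGroup.mk_surjective x
    obtain ⟨f, hf, hfw⟩ := h w
    exact ⟨f, hf, QuotientGroup.eq.mpr hfw⟩
  have : Finite (W ⧸ C) := Set.finite_univ_iff.mp hfin
  exact Subgroup.finiteIndex_of_finite_quotient

theorem exists_finite_cover (H A : Subgroup W) [H.FiniteIndex] :
    ∃ F : Set W, F.Finite ∧ F ⊆ A ∧ ∀ a ∈ A, ∃ f ∈ F, f⁻¹ * a ∈ H := by
  obtain ⟨F, hFA, hF⟩ := Set.exists_subset_bijOn (A : Set W) (QuotientGroup.mk : W → W ⧸ H)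
  refine ⟨F, hF.finite_iff_finite.mpr (Set.toFinite _), hFA, fun a ha => ?_⟩
  obtain ⟨f, hf, hfa⟩ := hF.surjOn ⟨a, ha, rfl⟩
  exact ⟨f, hf, QuotientGroup.eq.mp hfa⟩

variable (W) in
/-- Only the identity centralizes a subgroup of finite index. -/
def TrivialVirtualCenter : Prop :=
  ∀ H : Subgroup W, H.FiniteIndex → ∀ w, (∀ g ∈ H, Commute w g) → w = 1

/-- `G` is the internal direct product of `A` and `K`. -/
structure IsDecomp (G A K : Subgroup W) : Prop where
  le_left : A ≤ G
  le_right : K ≤ G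
  commute : ∀ a ∈ A, ∀ k ∈ K, Commute a k
  disjoint : ∀ x ∈ A, x ∈ K → x = 1
  exists_mul : ∀ g ∈ G, ∃ a ∈ A, ∃ k ∈ K, g = a * k

namespace IsDecomp

variable {G A K : Subgroup W}

theorem symm (h : IsDecomp G A K) : IsDecomp G K A where
  le_left := h.le_right
  le_right := h.le_left
  commute a ha k hk := (h.commute k hk a ha).symm
  disjoint x hx hx' := h.disjoint x hx' hx
  exists_mul g hg := by
    obtain ⟨a, ha, k, hk, rfl⟩ := h.exists_mul g hg
    exact ⟨k, hk, a, ha, h.commute a ha k hk⟩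

theorem eq_one_of_cover (hC : TrivialVirtualCenter W) [G.FiniteIndex] (h : IsDecomp G A K)
    (H : Subgroup W) [H.FiniteIndex] {a : W} (ha : a ∈ A) {F : Set W} (hF : F.Finite)
    (hcov : ∀ x ∈ A, x ∈ H → ∃ f ∈ F, Commute a (f⁻¹ * x)) : a = 1 := by
  obtain ⟨F₁, hF₁, -, h₁⟩ := exists_finite_cover G ⊤
  obtain ⟨F₂, hF₂, hF₂A, h₂⟩ := exists_finite_cover H A
  refine hC (Subgroup.centralizer {a}) ?_ a fun g hg =>
    (Subgroup.mem_centralizer_singleton_iff.mp hg).symm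
  refine finiteIndex_of_cover _ ((hF₁.mul hF₂).mul hF) fun w => ?_
  obtain ⟨f₁, hf₁, hw⟩ := h₁ w trivial
  obtain ⟨b, hb, k, hk, hbk⟩ := h.exists_mul _ hw
  obtain ⟨f₂, hf₂, hfb⟩ := h₂ b hb
  obtain ⟨f, hf, hfx⟩ := hcov _ (A.mul_mem (A.inv_mem (hF₂A hf₂)) hb) hfb
  refine ⟨f₁ * f₂ * f, Set.mul_mem_mul (Set.mul_mem_mul hf₁ hf₂) hf, ?_⟩
  have : (f₁ * f₂ * f)⁻¹ * w = f⁻¹ * (f₂⁻¹ * b) * k := by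
    simp only [mul_inv_rev, mul_assoc, hbk]
  rw [this, Subgroup.mem_centralizer_singleton_iff]
  exact (hfx.mul_right (h.commute a ha k hk)).symm.eq

theorem eq_one_of_commute (hC : TrivialVirtualCenter W) [G.FiniteIndex] (h : IsDecomp G A K)
    (H : Subgroup W) [H.FiniteIndex] {a : W} (ha : a ∈ A)
    (hcomm : ∀ x ∈ A, x ∈ H → Commute a x) : a = 1 :=
  h.eq_one_of_cover hC H ha (Set.finite_singleton 1) fun x hx hxH =>
    ⟨1, rfl, by simpa using hcomm x hx hxH⟩

theorem mem_left_of_commute (hC : TrivialVirtualCenter W) [G.FiniteIndex] (h : IsDecomp G A K)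
    (H : Subgroup W) [H.FiniteIndex] {x : W} (hx : x ∈ G)
    (hcomm : ∀ y ∈ K, y ∈ H → Commute x y) : x ∈ A := by
  obtain ⟨a, ha, k, hk, rfl⟩ := h.exists_mul x hx
  have : k = 1 := h.symm.eq_one_of_commute hC H hk fun y hy hyH => by
    have h1 := (h.commute a ha y hy).inv_left.mul_left (hcomm y hy hyH)
    rwa [inv_mul_cancel_left] at h1
  rwa [this, mul_one]

theorem left_eq (h : IsDecomp G A K) {a a' k k' : W} (ha : a ∈ A) (ha' : a' ∈ A) (hk : k ∈ K)
    (hk' : k' ∈ K) (he : a * k = a' * k') : a = a' := by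
  have h1 : a'⁻¹ * a = k' * k⁻¹ := by
    rw [eq_mul_inv_iff_mul_eq, mul_assoc, he, inv_mul_cancel_left]
  have h2 := h.disjoint _ (A.mul_mem (A.inv_mem ha') ha)
    (h1 ▸ K.mul_mem hk' (K.inv_mem hk))
  exact (inv_mul_eq_one.mp h2).symm

theorem commute_left (h : IsDecomp G A K) {a k y : W} (ha : a ∈ A) (hk : k ∈ K) (hy : y ∈ G)
    (hc : Commute (a * k) y) : Commute a y := by
  obtain ⟨b, hb, l, hl, rfl⟩ := h.exists_mul y hy
  have h1 : a * b * (k * l) = b * a * (l * k) := by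
    have := hc.eq
    rw [(h.commute a ha k hk).eq] at this
    calc a * b * (k * l) = a * (b * k) * l := by simp only [mul_assoc]
      _ = k * a * (b * l) := by
        rw [(h.commute b hb k hk).eq, ← mul_assoc, (h.commute a ha k hk).eq]
        simp only [mul_assoc]
      _ = b * l * (k * a) := this
      _ = b * a * (l * k) := by
        rw [← (h.commute a ha k hk).eq, mul_assoc, ← mul_assoc l, ← (h.commute a ha l hl).eq]
        simp only [mul_assoc]
  have h2 := h.left_eq (A.mul_mem ha hb) (A.mul_mem hb ha) (K.mul_mem hk hl) (K.mul_mem hl hk) h1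
  exact Commute.mul_right h2 (h.commute a ha l hl)

/-- The products of elements of `A ⊓ N` and `K ⊓ N`. -/
def mulInf (h : IsDecomp G A K) (N : Subgroup W) : Subgroup W where
  carrier := {x | ∃ a ∈ A ⊓ N, ∃ k ∈ K ⊓ N, x = a * k}
  one_mem' := ⟨1, one_mem _, 1, one_mem _, (mul_one 1).symm⟩
  mul_mem' := by
    rintro _ _ ⟨a, ha, k, hk, rfl⟩ ⟨b, hb, l, hl, rfl⟩
    refine ⟨a * b, mul_mem ha hb, k * l, mul_mem hk hl, ?_⟩
    rw [mul_assoc, ← mul_assoc k, ← (h.commute b hb.1 k hk.1).eq]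
    simp only [mul_assoc]
  inv_mem' := by
    rintro _ ⟨a, ha, k, hk, rfl⟩
    refine ⟨a⁻¹, inv_mem ha, k⁻¹, inv_mem hk, ?_⟩
    rw [← mul_inv_rev, (h.commute a ha.1 k hk.1).eq]

theorem finiteIndex_mulInf [G.FiniteIndex] (h : IsDecomp G A K) (N : Subgroup W) [N.FiniteIndex] :
    (h.mulInf N).FiniteIndex := by
  obtain ⟨F₁, hF₁, -, h₁⟩ := exists_finite_cover G ⊤
  obtain ⟨F₂, hF₂, hF₂A, h₂⟩ := exists_finite_cover N A
  obtain ⟨F₃, hF₃, hF₃K, h₃⟩ := exists_finite_cover N K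
  refine finiteIndex_of_cover _ ((hF₁.mul hF₂).mul hF₃) fun w => ?_
  obtain ⟨f₁, hf₁, hw⟩ := h₁ w trivial
  obtain ⟨a, ha, k, hk, hak⟩ := h.exists_mul _ hw
  obtain ⟨f₂, hf₂, hfa⟩ := h₂ a ha
  obtain ⟨f₃, hf₃, hfk⟩ := h₃ k hk
  have hA := A.mul_mem (A.inv_mem (hF₂A hf₂)) ha
  have hK := K.inv_mem (hF₃K hf₃)
  refine ⟨f₁ * f₂ * f₃, Set.mul_mem_mul (Set.mul_mem_mul hf₁ hf₂) hf₃, f₂⁻¹ * a, ⟨hA, hfa⟩,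
    f₃⁻¹ * k, ⟨K.mul_mem hK hk, hfk⟩, ?_⟩
  rw [← mul_assoc, (h.commute _ hA _ hK).eq]
  simp only [mul_inv_rev, mul_assoc, hak]

end IsDecomp

end Decomposition

section Swap

variable [Fintype B] {M : CoxeterMatrix B} {cs : CoxeterSystem M W}

theorem Reflects.eq {u v : W} {p : B → ℝ} (hu : Reflects cs u p) (hv : Reflects cs v p) :
    u = v := by
  apply rep_faithful cs
  ext1 x
  rw [hu, hv]

theorem Reflects.neg {u : W} {p : B → ℝ} (hu : Reflects cs u p) : Reflects cs u (-p) := by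
  intro x
  rw [hu, map_neg, LinearMap.neg_apply]
  module

theorem rep_eq_or_eq_neg_of_commute {s : B} {w : W} (h : Commute w (cs.simple s)) :
    rep cs w (simpleRoot s) = simpleRoot s ∨ rep cs w (simpleRoot s) = -simpleRoot s := by
  have h1 := (reflects_simple (cs := cs) s).conj w (simpleRoot s)
  rw [h.eq, mul_inv_cancel_right, reflects_simple, bil_simpleRoot, formEntry_self] at h1
  have h2 : simpleRoot s = bil M (rep cs w (simpleRoot s)) (simpleRoot s) •
      rep cs w (simpleRoot s) := by
    refine smul_right_injective _ (two_ne_zero (α := ℝ)) ?_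
    simp only
    rw [sub_right_inj] at h1
    rw [smul_smul, ← h1, mul_one]
  rcases ((isRoot_simpleRoot cs s).rep w).eq_or_eq_neg_of_smul (isRoot_simpleRoot cs s) h2 with
    h3 | h3
  · exact Or.inl h3.symm
  · right
    rw [eq_neg_iff_add_eq_zero, add_comm]
    exact eq_neg_iff_add_eq_zero.mp h3

theorem commute_simple_of_rep_eq {s : B} {w : W}
    (h : rep cs w (simpleRoot s) = simpleRoot s) : Commute w (cs.simple s) := by
  have h1 := (reflects_simple (cs := cs) s).conj w
  rw [h] at h1
  exact mul_inv_eq_iff_eq_mul.mp (h1.eq (reflects_simple s))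

theorem rep_zpow_eq {w : W} {p : B → ℝ} (h : rep cs w p = p) (n : ℤ) : rep cs (w ^ n) p = p := by
  let U : Subgroup W :=
    { carrier := {g | rep cs g p = p}
      one_mem' := rep_one_apply cs p
      mul_mem' := fun {a b} ha hb => by
        change rep cs (a * b) p = p
        rw [rep_mul_apply, show rep cs b p = p from hb, show rep cs a p = p from ha]
      inv_mem' := fun {a} ha => by
        change rep cs a⁻¹ p = p
        conv_lhs => rw [← show rep cs a p = p from ha]
        exact rep_inv_apply_self cs a p }
  exact U.zpow_mem (show w ∈ U from h) n

theorem not_forall_rep_zpow_nonneg {x : B → ℝ} (hx : IsRoot cs x) {T d : W}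
    (hT : Reflects cs T x)
    (hTd : ∀ n : ℤ, rep cs T (rep cs (d ^ n) x) = -rep cs (d ^ (-n)) x) (hdx : rep cs d x ≠ x) :
    ¬ ∀ n : ℤ, 0 ≤ rep cs (d ^ n) x := by
  intro hpos
  have hfin : (Set.range fun n : ℤ => rep cs (d ^ n) x).Finite := by
    refine (finite_inversions cs T).subset ?_
    rintro _ ⟨n, rfl⟩
    refine ⟨hx.rep _, hpos n, ?_⟩
    simp only [hTd]
    exact neg_nonpos.mpr (hpos _)
  set O := hfin.toFinset with hO
  have hmem : ∀ n : ℤ, rep cs (d ^ n) x ∈ O := fun n => by simp [hO]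
  have hO' : ∀ y ∈ O, ∃ n : ℤ, rep cs (d ^ n) x = y := fun y hy => by simpa [hO] using hy
  have hTs : rep cs T (∑ y ∈ O, y) = -∑ y ∈ O, y := by
    rw [map_sum, ← Finset.sum_neg_distrib]
    refine Finset.sum_bij (fun y _ => -rep cs T y) ?_ ?_ ?_ ?_
    · intro y hy
      obtain ⟨n, rfl⟩ := hO' y hy
      rw [hTd, neg_neg]
      exact hmem _
    · intro y _ z _ hyz
      exact rep_injective cs T (neg_injective hyz)
    · intro y hy
      obtain ⟨n, rfl⟩ := hO' y hy
      exact ⟨_, hmem (-n), by rw [hTd, neg_neg, neg_neg]⟩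
    · intro y _
      rw [neg_neg]
  have hds : rep cs d (∑ y ∈ O, y) = ∑ y ∈ O, y := by
    rw [map_sum]
    refine Finset.sum_bij (fun y _ => rep cs d y) ?_ ?_ ?_ fun _ _ => rfl
    · intro y hy
      obtain ⟨n, rfl⟩ := hO' y hy
      rw [← rep_mul_apply, ← zpow_one_add]
      exact hmem _
    · intro y _ z _ hyz
      exact rep_injective cs d hyz
    · intro y hy
      obtain ⟨n, rfl⟩ := hO' y hy
      refine ⟨_, hmem (n - 1), ?_⟩
      rw [← rep_mul_apply, ← zpow_one_add, add_sub_cancel]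
  set Y := ∑ y ∈ O, y with hY
  have hYx : Y = bil M x Y • x := by
    rw [hT] at hTs
    refine smul_right_injective _ (two_ne_zero (α := ℝ)) ?_
    simp only
    have h1 : (2 : ℝ) • Y = Y - -Y := by module
    rw [h1, ← hTs, sub_sub_cancel, mul_smul]
  have h0 : bil M x Y = 0 := by
    by_contra hc
    rw [hYx, map_smul] at hds
    exact hdx (smul_right_injective _ hc hds)
  have hY0 : Y = 0 := by rw [hYx, h0, zero_smul]
  have hxle : x ≤ Y := by
    refine Finset.single_le_sum (f := fun y => y) (fun y hy => ?_) (by simpa using hmem 0)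
    obtain ⟨n, rfl⟩ := hO' y hy
    exact hpos n
  exact hx.ne_zero (le_antisymm (hY0 ▸ hxle) (by simpa using hpos 0))

/-- If `D` commutes with, and is disjoint from, its conjugate by a simple reflection `s`, and
`s d s d` fixes the simple root of `s` for some `d ≠ 1` in `D`, then `d` generates a subgroup of
finite index in `D`. -/
theorem exists_finite_mul_zpow {s : B} {D : Subgroup W}
    (hcomm : ∀ d ∈ D, ∀ e ∈ D, Commute d (MulAut.conj (cs.simple s) e))
    (hdisj : ∀ d ∈ D, MulAut.conj (cs.simple s) d ∈ D → d = 1) {d : W} (hd : d ∈ D) (hd1 : d ≠ 1)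
    (hfix : rep cs (MulAut.conj (cs.simple s) d * d) (simpleRoot s) = simpleRoot s) :
    ∃ F : Set W, F.Finite ∧ F ⊆ D ∧ ∀ c ∈ D, ∃ f ∈ F, ∃ n : ℤ, c = f * d ^ n := by
  set σ := MulAut.conj (cs.simple s) with hσ
  set p : B → ℝ := simpleRoot s with hp
  have hσ_apply : ∀ x, σ x = cs.simple s * x * cs.simple s := fun x => by
    rw [hσ, MulAut.conj_apply, cs.inv_simple]
  have hσσ : ∀ x, σ (σ x) = x := fun x => by
    simp only [hσ_apply, mul_assoc, cs.simple_mul_simple_self, mul_one,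
      cs.simple_mul_simple_cancel_left]
  have hσ_commute : ∀ x, σ x = x → Commute x (cs.simple s) := by
    intro x hx
    rw [hσ_apply] at hx
    change x * cs.simple s = cs.simple s * x
    conv_lhs => rw [← hx]
    rw [mul_assoc, cs.simple_mul_simple_self, mul_one]
  have hσ_of_commute : ∀ x, Commute x (cs.simple s) → σ x = x := by
    intro x hx
    rw [hσ_apply, ← hx.eq, mul_assoc, cs.simple_mul_simple_self, mul_one]
  have htriv : ∀ e ∈ D, rep cs e p = p → e = 1 := by
    intro e he hep
    refine hdisj e he ?_
    rwa [hσ_of_commute e (commute_simple_of_rep_eq hep)]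
  have hpm : ∀ c ∈ D, rep cs (σ c * c) p = p ∨ rep cs (σ c * c) p = -p := by
    intro c hc
    refine rep_eq_or_eq_neg_of_commute (hσ_commute _ ?_)
    rw [map_mul, hσσ, (hcomm c hc c hc).eq]
  have hsflip : ∀ e ∈ D, rep cs (σ e * e) p = p → ∀ n : ℤ,
      rep cs (cs.simple s) (rep cs (e ^ n) p) = -rep cs (e ^ (-n)) p := by
    intro e he hep n
    have h1 := rep_zpow_eq hep n
    have hsp : rep cs (cs.simple s) p = -p := by
      rw [rep_simple, reflMap_simpleRoot_self]
    rw [(hcomm e he e he).symm.mul_zpow, ((hcomm e he e he).zpow_zpow n n).symm.eq, ← map_zpow,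
      hσ_apply] at h1
    rw [rep_mul_apply, rep_mul_apply, rep_mul_apply, hsp, map_neg, map_neg, map_neg] at h1
    apply rep_injective cs (e ^ n)
    rw [map_neg, ← rep_mul_apply cs (e ^ n) (e ^ (-n)), ← zpow_add, add_neg_cancel, zpow_zero,
      rep_one_apply]
    exact neg_eq_iff_eq_neg.mp h1
  have hlast : ∀ c ∈ D, ∃ n : ℤ, rep cs (d ^ n * c) p ∈
      {q : B → ℝ | IsRoot cs q ∧ 0 ≤ q ∧ rep cs d q ≤ 0} ∪
        -{q : B → ℝ | IsRoot cs q ∧ 0 ≤ q ∧ rep cs d q ≤ 0} := by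
    intro c hc
    obtain ⟨x, hx⟩ : ∃ x, x = rep cs c p := ⟨_, rfl⟩
    have hxr : IsRoot cs x := hx ▸ (isRoot_simpleRoot cs s).rep c
    have hT : Reflects cs (c * cs.simple s * c⁻¹) x := hx ▸ (reflects_simple s).conj c
    obtain ⟨e, he⟩ : ∃ e, e = c⁻¹ * d * c := ⟨_, rfl⟩
    have heD : e ∈ D := he ▸ D.mul_mem (D.mul_mem (D.inv_mem hc) hd) hc
    have hce : c * e = d * c := by rw [he]; group
    have hcen : ∀ n : ℤ, c * e ^ n = d ^ n * c := by
      intro n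
      have : e = c⁻¹ * d * c⁻¹⁻¹ := by rw [inv_inv, he]
      rw [this, conj_zpow]
      group
    have hep : rep cs (σ e * e) p = p := by
      have h1 : (σ c * c) * (σ e * e) = (σ d * d) * (σ c * c) := by
        calc (σ c * c) * (σ e * e) = σ c * (c * σ e) * e := by simp only [mul_assoc]
          _ = σ (c * e) * (c * e) := by
            rw [(hcomm c hc e heD).eq, map_mul]; simp only [mul_assoc]
          _ = σ d * (σ c * d) * c := by rw [hce, map_mul]; simp only [mul_assoc]
          _ = (σ d * d) * (σ c * c) := by
            rw [← (hcomm d hd c hc).eq]; simp only [mul_assoc]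
      apply rep_injective cs (σ c * c)
      rw [← rep_mul_apply, h1, rep_mul_apply]
      rcases hpm c hc with h2 | h2
      · rw [h2, hfix]
      · rw [h2, map_neg, hfix]
    have hTd : ∀ n : ℤ, rep cs (c * cs.simple s * c⁻¹) (rep cs (d ^ n) x) =
        -rep cs (d ^ (-n)) x := by
      intro n
      have h1 := hsflip e heD hep n
      have h2 : c * cs.simple s * c⁻¹ * d ^ n * c = c * (cs.simple s * e ^ n) := by
        rw [mul_assoc _ (d ^ n), ← hcen]
        group
      rw [hx, ← rep_mul_apply, ← rep_mul_apply, ← rep_mul_apply, h2, ← hcen, rep_mul_apply,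
        rep_mul_apply, h1, map_neg, ← rep_mul_apply]
    have hdx : rep cs d x ≠ x := by
      intro hc'
      have h1 : rep cs e p = p := by
        apply rep_injective cs c
        rw [← rep_mul_apply, hce, rep_mul_apply, ← hx, hc']
      have h2 := htriv e heD h1
      rw [h2, mul_one] at hce
      exact hd1 (mul_eq_right.mp hce.symm)
    have hn1 := not_forall_rep_zpow_nonneg hxr hT hTd hdx
    have hn2 := not_forall_rep_zpow_nonneg hxr.neg hT.neg (d := d)
      (fun n => by rw [map_neg, map_neg, hTd, map_neg]) (by rwa [map_neg, ne_eq, neg_inj])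
    have hroot : ∀ n : ℤ, IsRoot cs (rep cs (d ^ n) x) := fun n => hxr.rep _
    have hsucc : ∀ n : ℤ, rep cs (d ^ (n + 1)) x = rep cs d (rep cs (d ^ n) x) := fun n => by
      rw [← rep_mul_apply, ← zpow_one_add, add_comm]
    by_contra hcon
    push Not at hcon
    have hstep : ∀ n : ℤ, 0 ≤ rep cs (d ^ (n + 1)) x ↔ 0 ≤ rep cs (d ^ n) x := by
      intro n
      have hcn := hcon n
      rw [rep_mul_apply, ← hx] at hcn
      constructor
      · intro h1
        by_contra h2
        have h3 := (hroot n).nonneg_or_nonpos.resolve_left h2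
        refine hcn (Or.inr ⟨(hroot n).neg, neg_nonneg.mpr h3, ?_⟩)
        rw [map_neg, ← hsucc]
        exact neg_nonpos.mpr h1
      · intro h1
        by_contra h2
        have h3 := (hroot (n + 1)).nonneg_or_nonpos.resolve_left h2
        exact hcn (Or.inl ⟨hroot n, h1, hsucc n ▸ h3⟩)
    have hall : ∀ n : ℤ, 0 ≤ rep cs (d ^ n) x ↔ 0 ≤ x := by
      intro n
      induction n using Int.induction_on with
      | zero => simp
      | succ n ih => rw [hstep, ih]
      | pred n ih => rw [← hstep, sub_add_cancel, ih]
    rcases hxr.nonneg_or_nonpos with h1 | h1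
    · exact hn1 fun n => (hall n).mpr h1
    · refine hn2 fun n => ?_
      rw [map_neg]
      refine neg_nonneg.mpr ((hroot n).nonneg_or_nonpos.resolve_left fun h2 => ?_)
      exact hxr.ne_zero (le_antisymm h1 ((hall n).mp h2))
  set I := {q : B → ℝ | IsRoot cs q ∧ 0 ≤ q ∧ rep cs d q ≤ 0} ∪
    -{q : B → ℝ | IsRoot cs q ∧ 0 ≤ q ∧ rep cs d q ≤ 0} with hI
  have hIfin : I.Finite := (finite_inversions cs d).union (finite_inversions cs d).neg
  have hEfin : {e | e ∈ D ∧ rep cs e p ∈ I}.Finite := by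
    refine Set.Finite.of_injOn (f := fun e => rep cs e p) (fun e he => he.2) ?_ hIfin
    intro e he e' he' hee
    have h1 : rep cs (e⁻¹ * e') p = p := by
      rw [rep_mul_apply, ← show rep cs e p = rep cs e' p from hee, rep_inv_apply_self]
    exact inv_mul_eq_one.mp (htriv _ (D.mul_mem (D.inv_mem he.1) he'.1) h1)
  refine ⟨_, hEfin.inv, fun f hf => inv_mem_iff.mp hf.1, fun c hc => ?_⟩
  obtain ⟨n, hn⟩ := hlast c⁻¹ (D.inv_mem hc)
  refine ⟨(d ^ n * c⁻¹)⁻¹, ?_, n, by group⟩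
  rw [Set.mem_inv, inv_inv]
  exact ⟨D.mul_mem (D.zpow_mem hd n) (D.inv_mem hc), hn⟩

end Swap

section Conjugation

variable [Fintype B] {M : CoxeterMatrix B} {cs : CoxeterSystem M W} {G A K : Subgroup W}

namespace IsDecomp

/-- A simple reflection conjugates sufficiently deep elements of the factor `A` into `A`. -/
theorem conj_simple_mem_of_mem (hC : TrivialVirtualCenter W) [G.FiniteIndex]
    (h : IsDecomp G A K) {N N' : Subgroup W} [N.Normal] [N.FiniteIndex] [N'.Normal]
    [N'.FiniteIndex] (hNG : N ≤ G) (hN' : ∀ x ∈ N', ∃ a ∈ A ⊓ N, ∃ k ∈ K ⊓ N, x = a * k) (s : B)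
    {a : W} (ha : a ∈ A) (haN : a ∈ N') : MulAut.conj (cs.simple s) a ∈ A := by
  set σ := MulAut.conj (cs.simple s) with hσ
  have hσ_apply : ∀ x, σ x = cs.simple s * x * cs.simple s := fun x => by
    rw [hσ, MulAut.conj_apply, cs.inv_simple]
  have hσσ : ∀ x, σ (σ x) = x := fun x => by
    simp only [hσ_apply, mul_assoc, cs.simple_mul_simple_self, mul_one,
      cs.simple_mul_simple_cancel_left]
  have hσN : ∀ x ∈ N, σ x ∈ N := fun x hx => ‹N.Normal›.conj_mem x hx _
  have hσN' : ∀ x ∈ N', σ x ∈ N' := fun x hx => ‹N'.Normal›.conj_mem x hx _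
  let D : Subgroup W := A ⊓ N ⊓ K.comap σ.toMonoidHom
  have hDA : ∀ d ∈ D, d ∈ A := fun d hd => hd.1.1
  have hDK : ∀ d ∈ D, σ d ∈ K := fun d hd => hd.2
  have hcomm : ∀ d ∈ D, ∀ e ∈ D, Commute d (σ e) := fun d hd e he =>
    h.commute d (hDA d hd) _ (hDK e he)
  have hdisj : ∀ d ∈ D, σ d ∈ D → d = 1 := fun d hd hd' => by
    have := h.disjoint _ (hDA _ hd') (hDK d hd)
    rwa [map_eq_one_iff σ σ.injective] at this
  have hfactor : ∀ x ∈ A, x ∈ N' → ∃ b ∈ A, ∃ c ∈ D, σ b ∈ A ∧ x = σ b * c := by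
    intro x hx hxN
    obtain ⟨b, hb, k, hk, hbk⟩ := hN' _ (hσN' x hxN)
    have hbA : σ b ∈ A := by
      refine h.mem_left_of_commute hC N (hNG (hσN b hb.2)) fun y hy hyN => ?_
      have h1 : Commute (b * k) (σ y) := hbk ▸ (h.commute x hx y hy).map σ
      have h2 := (h.commute_left hb.1 hk.1 (hNG (hσN y hyN)) h1).map σ
      rwa [hσσ] at h2
    have hxe : x = σ b * σ k := by rw [← map_mul, ← hbk, hσσ]
    refine ⟨b, hb.1, σ k, ⟨⟨?_, hσN k hk.2⟩, ?_⟩, hbA, hxe⟩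
    · rw [eq_inv_mul_of_mul_eq hxe.symm]
      exact A.mul_mem (A.inv_mem hbA) hx
    · change σ (σ k) ∈ K
      rw [hσσ]
      exact hk.1
  have hbD : ∀ b ∈ A, ∀ e ∈ D, Commute (σ b) e := fun b hb e he => by
    simpa only [hσσ] using (h.commute b hb _ (hDK e he)).map σ
  have hsq : ∀ d ∈ D, d * d = 1 := by
    intro d hd
    by_contra hd1
    have hdd : d * d ∈ D := D.mul_mem hd hd
    have hw : Commute (σ d * d) (cs.simple s) := by
      have h1 : σ (σ d * d) = σ d * d := by rw [map_mul, hσσ, (hcomm d hd d hd).eq]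
      rw [hσ_apply] at h1
      change _ = _
      conv_lhs => rw [← h1]
      rw [mul_assoc, cs.simple_mul_simple_self, mul_one]
    have hfix : rep cs (σ (d * d) * (d * d)) (simpleRoot s) = simpleRoot s := by
      have h1 : σ (d * d) * (d * d) = σ d * d * (σ d * d) := by
        rw [map_mul, (hcomm d hd d hd).symm.mul_mul_mul_comm]
      rw [h1, rep_mul_apply]
      rcases rep_eq_or_eq_neg_of_commute hw with h2 | h2
      · rw [h2, h2]
      · rw [h2, map_neg, h2, neg_neg]
    obtain ⟨F, hF, hFD, hcov⟩ := exists_finite_mul_zpow hcomm hdisj hdd hd1 hfix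
    refine hd1 (h.eq_one_of_cover hC N' (hDA _ hdd) hF fun x hx hxN => ?_)
    obtain ⟨b, hb, c, hc, -, rfl⟩ := hfactor x hx hxN
    obtain ⟨f, hf, n, rfl⟩ := hcov c hc
    refine ⟨f, hf, ?_⟩
    rw [← mul_assoc (σ b), (hbD b hb f (hFD hf)).eq, mul_assoc f, inv_mul_cancel_left]
    exact (hbD b hb _ hdd).symm.mul_right (Commute.self_zpow _ n)
  have hD1 : ∀ d ∈ D, d = 1 := by
    intro d hd
    refine h.eq_one_of_commute hC N' (hDA d hd) fun x hx hxN => ?_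
    obtain ⟨b, hb, c, hc, -, rfl⟩ := hfactor x hx hxN
    refine (hbD b hb d hd).symm.mul_right ?_
    have hinv : ∀ e ∈ D, e⁻¹ = e := fun e he => inv_eq_of_mul_eq_one_left (hsq e he)
    have h1 := hinv _ (D.mul_mem hd hc)
    rw [mul_inv_rev, hinv d hd, hinv c hc] at h1
    exact h1.symm
  obtain ⟨b, hb, c, hc, hbA, rfl⟩ := hfactor a ha haN
  rw [hD1 c hc, mul_one, hσσ]
  exact hb

/-- If a normal subgroup of finite index splits compatibly with `G = A × K`, then
`A ⊓ N` is normal in the Coxeter group. -/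
theorem normal_inf (hC : TrivialVirtualCenter W) [G.FiniteIndex] (cs : CoxeterSystem M W)
    (h : IsDecomp G A K) {N N' : Subgroup W} [N.Normal] [N.FiniteIndex] [N'.Normal]
    [N'.FiniteIndex] (hNG : N ≤ G)
    (hN' : ∀ x ∈ N', ∃ a ∈ A ⊓ N, ∃ k ∈ K ⊓ N, x = a * k) : (A ⊓ N).Normal := by
  have hK : ∀ x ∈ N', ∃ k ∈ K ⊓ N, ∃ a ∈ A ⊓ N, x = k * a := fun x hx => by
    obtain ⟨a, ha, k, hk, rfl⟩ := hN' x hx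
    exact ⟨k, hk, a, ha, h.commute a ha.1 k hk.1⟩
  refine ⟨fun a ha w => ?_⟩
  refine cs.simple_induction (p := fun w => ∀ a ∈ A ⊓ N, w * a * w⁻¹ ∈ A ⊓ N) w ?_ ?_ ?_ a ha
  · intro s a ha
    have hN := ‹N.Normal›.conj_mem a ha.2 (cs.simple s)
    refine ⟨h.mem_left_of_commute hC N' (hNG hN) fun y hy hyN => ?_, hN⟩
    have h1 := h.symm.conj_simple_mem_of_mem (cs := cs) hC hNG hK s hy hyN
    have h2 := (h.commute a ha.1 _ h1).map (MulAut.conj (cs.simple s))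
    rw [← MulAut.mul_apply, ← map_mul, cs.simple_mul_simple_self, map_one, MulAut.one_apply] at h2
    exact h2
  · intro a ha
    simpa using ha
  · intro w w' hw hw' a ha
    simpa only [mul_inv_rev, mul_assoc] using hw _ (hw' a ha)

/-- A factor whose normal part fixes the line of a simple root is trivial. -/
theorem left_eq_bot (hC : TrivialVirtualCenter W) [G.FiniteIndex]
    (hirr : (coxeterGraph M).Connected) (cs : CoxeterSystem M W)
    (h : IsDecomp G A K) {N : Subgroup W} [N.FiniteIndex] (hA : (A ⊓ N).Normal) {s : B}
    (hs : ∀ a ∈ A ⊓ N,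
      rep cs a (simpleRoot s) = simpleRoot s ∨ rep cs a (simpleRoot s) = -simpleRoot s) :
    A = ⊥ := by
  let U : Submodule ℝ (B → ℝ) :=
    { carrier := {x | ∀ a ∈ A ⊓ N, ∀ b ∈ A ⊓ N, rep cs (a * b) x = rep cs (b * a) x}
      zero_mem' := fun a _ b _ => by simp only [map_zero]
      add_mem' := fun {x y} hx hy a ha b hb => by
        simp only [map_add, hx a ha b hb, hy a ha b hb]
      smul_mem' := fun c x hx a ha b hb => by simp only [map_smul, hx a ha b hb] }
  have hU : U = ⊤ := by
    refine eq_top_of_invariant (cs := cs) hirr (fun t x hx a ha b hb => ?_)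
      (isRoot_simpleRoot cs s) fun a ha b hb => ?_
    · have h1 := hx _ (hA.conj_mem a ha (cs.simple t)) _ (hA.conj_mem b hb (cs.simple t))
      apply rep_injective cs (cs.simple t)
      simp only [← rep_mul_apply]
      simpa only [cs.inv_simple, mul_assoc, cs.simple_mul_simple_cancel_left] using h1
    · rcases hs a ha with h1 | h1 <;> rcases hs b hb with h2 | h2 <;>
        simp only [rep_mul_apply, h1, h2, map_neg]
  have hcomm : ∀ a ∈ A ⊓ N, ∀ b ∈ A ⊓ N, Commute a b := by
    intro a ha b hb
    apply rep_faithful cs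
    ext1 x
    exact (hU ▸ Submodule.mem_top : x ∈ U) a ha b hb
  have h1 : ∀ a ∈ A ⊓ N, a = 1 := fun a ha =>
    h.eq_one_of_commute hC N ha.1 fun x hx hxN => hcomm a ha x ⟨hx, hxN⟩
  refine (Subgroup.eq_bot_iff_forall _).mpr fun a ha =>
    h.eq_one_of_commute hC N ha fun x hx hxN => ?_
  rw [h1 x ⟨hx, hxN⟩]
  exact Commute.one_right a

theorem rep_mem_span_of_mem_right (hirr : (coxeterGraph M).Connected)
    (hform : ¬ ∀ x : B → ℝ, 0 ≤ canonicalForm M x x) (h : IsDecomp G A K) {N : Subgroup W}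
    (hA : (A ⊓ N).Normal) {s : B} {a : W} (ha : a ∈ A ⊓ N)
    (h1 : rep cs a (simpleRoot s) ≠ simpleRoot s) (h2 : rep cs a (simpleRoot s) ≠ -simpleRoot s)
    {k : W} (hk : k ∈ K) :
    rep cs k (simpleRoot s) ∈ Submodule.span ℝ {simpleRoot s, rep cs a (simpleRoot s)} := by
  refine rep_mem_span_pair_of_commute hirr hform (isRoot_simpleRoot cs s)
    ((isRoot_simpleRoot cs s).rep a) h1 h2 (reflects_simple s) ((reflects_simple s).conj a) ?_
  refine (h.commute _ ?_ k hk).symm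
  have h3 : _ ∈ A := A.mul_mem (hA.conj_mem a ha (cs.simple s)).1 (A.inv_mem ha.1)
  rw [cs.inv_simple] at h3
  simpa only [mul_assoc] using h3

theorem eq_bot_or_eq_bot (hC : TrivialVirtualCenter W) [G.FiniteIndex]
    (hirr : (coxeterGraph M).Connected) (hinf : Infinite W)
    (hform : ¬ ∀ x : B → ℝ, 0 ≤ canonicalForm M x x) (cs : CoxeterSystem M W)
    (h : IsDecomp G A K) : A = ⊥ ∨ K = ⊥ := by
  set N := G.normalCore
  have hNG : N ≤ G := G.normalCore_le
  have := h.finiteIndex_mulInf N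
  set N' := (h.mulInf N).normalCore
  have hN' : ∀ x ∈ N', ∃ a ∈ A ⊓ N, ∃ k ∈ K ⊓ N, x = a * k := fun x hx =>
    (h.mulInf N).normalCore_le hx
  have hAN := h.normal_inf hC cs hNG hN'
  have hKN := h.symm.normal_inf hC cs hNG (N' := N') fun x hx => by
    obtain ⟨a, ha, k, hk, rfl⟩ := hN' x hx
    exact ⟨k, hk, a, ha, h.commute a ha.1 k hk.1⟩
  obtain ⟨s⟩ := hirr.nonempty
  by_contra! hne
  have hA : ∃ a ∈ A ⊓ N,
      rep cs a (simpleRoot s) ≠ simpleRoot s ∧ rep cs a (simpleRoot s) ≠ -simpleRoot s := by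
    by_contra! hA
    exact hne.1 (h.left_eq_bot hC hirr cs hAN fun a ha => or_iff_not_imp_left.mpr (hA a ha))
  have hK : ∃ k ∈ K ⊓ N,
      rep cs k (simpleRoot s) ≠ simpleRoot s ∧ rep cs k (simpleRoot s) ≠ -simpleRoot s := by
    by_contra! hK
    exact hne.2 (h.symm.left_eq_bot hC hirr cs hKN fun k hk => or_iff_not_imp_left.mpr (hK k hk))
  obtain ⟨a, ha, ha1, ha2⟩ := hA
  obtain ⟨k, hk, hk1, hk2⟩ := hK
  set p : B → ℝ := simpleRoot s
  have hp : IsRoot cs p := isRoot_simpleRoot cs s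
  set P := Submodule.span ℝ {p, rep cs a p}
  have hpP : p ∈ P := Submodule.subset_span (Set.mem_insert _ _)
  have hKP : ∀ l ∈ K, rep cs l p ∈ P := fun l hl =>
    h.rep_mem_span_of_mem_right hirr hform hAN ha ha1 ha2 hl
  have hAP : ∀ b ∈ A, rep cs b p ∈ P := fun b hb => by
    refine Submodule.span_le.mpr ?_
      (h.symm.rep_mem_span_of_mem_right hirr hform hKN hk hk1 hk2 hb)
    rintro _ (rfl | rfl)
    exacts [hpP, hKP k hk.1]
  have hP : ∀ x ∈ N', rep cs x p ∈ P := by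
    intro x hx
    obtain ⟨b, hb, l, hl, rfl⟩ := hN' x hx
    obtain ⟨c, c', hc⟩ := Submodule.mem_span_pair.mp (hKP l hl.1)
    rw [rep_mul_apply, ← hc, map_add, map_smul, map_smul, ← rep_mul_apply]
    exact P.add_mem (P.smul_mem _ (hAP b hb.1)) (P.smul_mem _ (hAP _ (A.mul_mem hb.1 ha.1)))
  obtain ⟨n, hn, hn1, hn2⟩ := hp.exists_rep_ne hirr hinf N'
  obtain ⟨m, hm, hmp⟩ := hp.exists_rep_notMem hirr hinf hform N' hn hn1 hn2
  obtain ⟨c, c', hc⟩ := Submodule.mem_span_pair.mp (hP n hn)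
  refine hmp (Submodule.span_le.mpr ?_ (hP m hm))
  have hc' : c' ≠ 0 := by
    rintro rfl
    rw [zero_smul, add_zero] at hc
    rcases hp.eq_or_eq_neg_of_smul (hp.rep n) hc.symm with h1 | h1
    exacts [hn1 h1, hn2 h1]
  rintro _ (rfl | rfl)
  · exact Submodule.subset_span (Set.mem_insert _ _)
  · refine Submodule.mem_span_pair.mpr ⟨-(c'⁻¹ * c), c'⁻¹, ?_⟩
    rw [← hc, smul_add, smul_smul, smul_smul, inv_mul_cancel₀ hc']
    module

end IsDecomp

end Conjugation

/-- **Theorem 4.1, part 2.** An irreducible, non-spherical, non-affine Coxeter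
group is strongly indecomposable: for every finite index subgroup `G` of `W` and every internal
direct product decomposition `G = A × K` (`A, K ≤ G` normal in `G`, `A ⊓ K = {1}`, `A K = G`),
one of the factors is trivial. -/
theorem strongly_indecomposable
    [Fintype B] {M : CoxeterMatrix B} (cs : CoxeterSystem M W)
    (hirr : (coxeterGraph M).Connected) (hinf : Infinite W)
    (hform : ¬ ∀ x : B → ℝ, 0 ≤ canonicalForm M x x)
    (G : Subgroup W) (hG : G.FiniteIndex)
    (A K : Subgroup W) (hAle : A ≤ G) (hKle : K ≤ G)
    (hA : ∀ g ∈ G, ∀ a ∈ A, g * a * g⁻¹ ∈ A)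
    (hK : ∀ g ∈ G, ∀ k ∈ K, g * k * g⁻¹ ∈ K)
    (hinter : A ⊓ K = ⊥)
    (hprod : ∀ g ∈ G, ∃ a ∈ A, ∃ k ∈ K, g = a * k) :
    A = ⊥ ∨ K = ⊥ := by
  have hdisj : ∀ x ∈ A, x ∈ K → x = 1 := fun x hx hx' => by
    have : x ∈ A ⊓ K := ⟨hx, hx'⟩
    rwa [hinter, Subgroup.mem_bot] at this
  have h : IsDecomp G A K :=
    { le_left := hAle
      le_right := hKle
      commute := fun a ha k hk => by
        refine mul_inv_eq_one.mp (hdisj _ ?_ ?_)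
        · have h1 := A.mul_mem ha (hA k (hKle hk) _ (A.inv_mem ha))
          simpa only [mul_inv_rev, mul_assoc] using h1
        · have h1 := K.mul_mem (hK a (hAle ha) _ hk) (K.inv_mem hk)
          simpa only [mul_inv_rev, mul_assoc] using h1
      disjoint := hdisj
      exists_mul := hprod }
  refine h.eq_bot_or_eq_bot (fun H hH w hw => ?_) hirr hinf hform cs
  exact eq_one_of_finiteIndex_le_centralizer hirr hinf hform cs H hw

end CoxeterPaper
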